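/- arXiv:1109.1863 — 9 statements merged into one kernel-verified Lean document; each statement's English description precedes it below -/
import Mathlib

section
/- Let G be an amenable discrete group, H a complex Hilbert space, and π a uniformly bounded representation of G on H. Then there exists an invertible bounded linear operator S on H with ‖S‖·‖S⁻¹‖ ≤ |π|² such that t ↦ S⁻¹ π(t) S is a unitary representation of G (i.e. S⁻¹π(t)S is a unitary operator for every t ∈ G). In particular, every amenable discrete group is unitarizable. -/
/-- A discrete group `G` is amenable: there exists a left-invariant mean on the
bounded real-valued functions on `G`. -/
def IsAmenable (G : Type*) [Group G] : Prop :=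
  ∃ m : (G → ℝ) → ℝ,
    (∀ f₁ f₂ : G → ℝ, (∃ C, ∀ x, |f₁ x| ≤ C) → (∃ C, ∀ x, |f₂ x| ≤ C) →
      m (f₁ + f₂) = m f₁ + m f₂) ∧
    (∀ (c : ℝ) (f : G → ℝ), (∃ C, ∀ x, |f x| ≤ C) → m (c • f) = c * m f) ∧
    (∀ f : G → ℝ, (∃ C, ∀ x, |f x| ≤ C) → (∀ x, 0 ≤ f x) → 0 ≤ m f) ∧
    m 1 = 1 ∧
    (∀ (g : G) (f : G → ℝ), (∃ C, ∀ x, |f x| ≤ C) → m (fun t => f (g⁻¹ * t)) = m f)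

open scoped InnerProductSpace

/-- An invariant mean on real-valued bounded functions extends to complex-valued ones. -/
theorem IsAmenable.exists_complex_mean {G : Type*} [Group G] (hG : IsAmenable G) :
    ∃ M : (G → ℂ) → ℂ,
      (∀ f₁ f₂ : G → ℂ, (∃ C, ∀ x, ‖f₁ x‖ ≤ C) → (∃ C, ∀ x, ‖f₂ x‖ ≤ C) →
        M (f₁ + f₂) = M f₁ + M f₂) ∧
      (∀ (c : ℂ) (f : G → ℂ), (∃ C, ∀ x, ‖f x‖ ≤ C) → M (c • f) = c * M f) ∧
      (∀ (f : G → ℂ) (C : ℝ), (∀ x, ‖f x‖ ≤ C) → ‖M f‖ ≤ 2 * C) ∧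
      (∀ (f : G → ℝ) (a b : ℝ), (∀ x, a ≤ f x) → (∀ x, f x ≤ b) →
        ∃ r : ℝ, M (fun x => (f x : ℂ)) = r ∧ a ≤ r ∧ r ≤ b) ∧
      (∀ (g : G) (f : G → ℂ), (∃ C, ∀ x, ‖f x‖ ≤ C) → M (fun t => f (g⁻¹ * t)) = M f) := by
  obtain ⟨m, hadd, hsmul, hpos, hone, hinv⟩ := hG
  have bre {f : G → ℂ} (hf : ∃ C, ∀ x, ‖f x‖ ≤ C) : ∃ C, ∀ x, |(f x).re| ≤ C :=
    hf.imp fun _ h x => (Complex.abs_re_le_norm _).trans (h x)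
  have bim {f : G → ℂ} (hf : ∃ C, ∀ x, ‖f x‖ ≤ C) : ∃ C, ∀ x, |(f x).im| ≤ C :=
    hf.imp fun _ h x => (Complex.abs_im_le_norm _).trans (h x)
  have bsmul (c : ℝ) {f : G → ℝ} (hf : ∃ C, ∀ x, |f x| ≤ C) : ∃ C, ∀ x, |(c • f) x| ≤ C := by
    obtain ⟨C, hC⟩ := hf
    refine ⟨|c| * C, fun x => ?_⟩
    simp only [Pi.smul_apply, smul_eq_mul, abs_mul]
    exact mul_le_mul_of_nonneg_left (hC x) (abs_nonneg c)
  have b1 : ∃ C, ∀ x, |(1 : G → ℝ) x| ≤ C := ⟨1, by simp⟩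
  have hlow (f : G → ℝ) (hf : ∃ C, ∀ x, |f x| ≤ C) (a : ℝ) (ha : ∀ x, a ≤ f x) : a ≤ m f := by
    have h₁ : m (f + (-a) • (1 : G → ℝ)) = m f + -a * 1 := by
      rw [hadd f _ hf (bsmul _ b1), hsmul _ _ b1, hone]
    have h₂ : 0 ≤ m (f + (-a) • (1 : G → ℝ)) := by
      obtain ⟨C, hC⟩ := hf
      refine hpos _ ⟨C + |a|, fun x => ?_⟩ fun x => ?_
      · have := abs_add_le (f x) (-a)
        rw [abs_neg] at this
        simpa using this.trans (by linarith [hC x])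
      · simpa using ha x
    linarith
  have hup (f : G → ℝ) (hf : ∃ C, ∀ x, |f x| ≤ C) (b : ℝ) (hb : ∀ x, f x ≤ b) : m f ≤ b := by
    have := hlow ((-1 : ℝ) • f) (bsmul _ hf) (-b) (fun x => by simpa using hb x)
    rw [hsmul _ _ hf] at this
    linarith
  have hnorm (f : G → ℝ) (C : ℝ) (hC : ∀ x, |f x| ≤ C) : |m f| ≤ C :=
    abs_le.2 ⟨hlow f ⟨C, hC⟩ _ fun x => (abs_le.1 (hC x)).1,
      hup f ⟨C, hC⟩ _ fun x => (abs_le.1 (hC x)).2⟩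
  refine ⟨fun f => ⟨m fun x => (f x).re, m fun x => (f x).im⟩, ?_, ?_, ?_, ?_, ?_⟩
  · intro f₁ f₂ h₁ h₂
    exact Complex.ext (hadd _ _ (bre h₁) (bre h₂)) (hadd _ _ (bim h₁) (bim h₂))
  · intro c f hf
    refine Complex.ext ?_ ?_
    · have : (fun x => ((c • f) x).re) =
          c.re • (fun x => (f x).re) + (-c.im) • fun x => (f x).im := by
        ext x
        simp [sub_eq_add_neg]
      simp only [this, hadd _ _ (bsmul _ (bre hf)) (bsmul _ (bim hf)), hsmul _ _ (bre hf),
        hsmul _ _ (bim hf), Complex.mul_re]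
      ring
    · have : (fun x => ((c • f) x).im) =
          c.re • (fun x => (f x).im) + c.im • fun x => (f x).re := by
        ext x
        simp
      simp only [this, hadd _ _ (bsmul _ (bim hf)) (bsmul _ (bre hf)), hsmul _ _ (bre hf),
        hsmul _ _ (bim hf), Complex.mul_im]
  · intro f C hC
    refine (Complex.norm_le_abs_re_add_abs_im _).trans ?_
    have h₁ := hnorm (fun x => (f x).re) C fun x => (Complex.abs_re_le_norm _).trans (hC x)
    have h₂ := hnorm (fun x => (f x).im) C fun x => (Complex.abs_im_le_norm _).trans (hC x)
    simp only
    linarith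
  · intro f a b ha hb
    have hf : ∃ C, ∀ x, |f x| ≤ C :=
      ⟨max (-a) b, fun x => abs_le.2 ⟨by linarith [le_max_left (-a) b, ha x],
        (hb x).trans (le_max_right _ _)⟩⟩
    refine ⟨m f, Complex.ext rfl ?_, hlow f hf a ha, hup f hf b hb⟩
    exact (congrArg m (by ext; simp)).trans ((hsmul 0 f hf).trans (zero_mul _))
  · intro g f hf
    exact Complex.ext (hinv g _ (bre hf)) (hinv g _ (bim hf))

/-- A uniformly bounded representation of an amenable group leaves invariant the form of a
positive operator that is bounded above and below. -/
theorem IsAmenable.exists_invariant_form {G : Type*} [Group G] (hG : IsAmenable G)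
    {H : Type*} [NormedAddCommGroup H] [InnerProductSpace ℂ H] [CompleteSpace H]
    (π : G →* (H →L[ℂ] H)ˣ) {C : ℝ} (hC : ∀ g : G, ‖(π g : H →L[ℂ] H)‖ ≤ C) :
    ∃ T : H →L[ℂ] H,
      (∀ x, ∃ r : ℝ, ⟪T x, x⟫_ℂ = r ∧ ‖x‖ ^ 2 ≤ C ^ 2 * r ∧ r ≤ C ^ 2 * ‖x‖ ^ 2) ∧
      ∀ g x y, ⟪T ((π g : H →L[ℂ] H) x), (π g : H →L[ℂ] H) y⟫_ℂ = ⟪T x, y⟫_ℂ := by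
  obtain ⟨M, hadd, hsmul, hnorm, hreal, hinv⟩ := hG.exists_complex_mean
  have hC0 : 0 ≤ C := (norm_nonneg _).trans (hC 1)
  let F (x y : H) (t : G) : ℂ := ⟪(π t⁻¹ : H →L[ℂ] H) x, (π t⁻¹ : H →L[ℂ] H) y⟫_ℂ
  have hπ (t : G) (x : H) : ‖(π t : H →L[ℂ] H) x‖ ≤ C * ‖x‖ :=
    (π t : H →L[ℂ] H).le_of_opNorm_le (hC t) x
  have hF (x y : H) (t : G) : ‖F x y t‖ ≤ C ^ 2 * (‖x‖ * ‖y‖) :=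
    calc ‖F x y t‖ ≤ _ := norm_inner_le_norm _ _
      _ ≤ (C * ‖x‖) * (C * ‖y‖) := by gcongr <;> exact hπ _ _
      _ = _ := by ring
  have bF (x y : H) : ∃ K, ∀ t, ‖F x y t‖ ≤ K := ⟨_, hF x y⟩
  let B : H →L⋆[ℂ] H →L[ℂ] ℂ := LinearMap.mkContinuous₂
    (LinearMap.mk₂'ₛₗ (starRingEnd ℂ) (RingHom.id ℂ) (fun x y => M (F x y))
      (fun x₁ x₂ y => by
        rw [← hadd _ _ (bF _ _) (bF _ _)]
        congr 1
        ext t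
        simp [F])
      (fun c x y => by
        rw [smul_eq_mul, ← hsmul _ _ (bF _ _)]
        congr 1
        ext t
        simp [F, mul_comm])
      (fun x y₁ y₂ => by
        rw [← hadd _ _ (bF _ _) (bF _ _)]
        congr 1
        ext t
        simp [F])
      (fun c x y => by
        rw [smul_eq_mul, RingHom.id_apply, ← hsmul _ _ (bF _ _)]
        congr 1
        ext t
        simp [F]))
    (2 * C ^ 2) fun x y => (hnorm _ _ (hF x y)).trans_eq (by ring)
  have hB (x y : H) : ⟪InnerProductSpace.continuousLinearMapOfBilin B x, y⟫_ℂ = M (F x y) :=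
    InnerProductSpace.continuousLinearMapOfBilin_apply B x y
  refine ⟨InnerProductSpace.continuousLinearMapOfBilin B, fun x => ?_, fun g x y => ?_⟩
  · rw [hB]
    have hlow (t : G) : ‖x‖ ^ 2 / C ^ 2 ≤ ‖(π t⁻¹ : H →L[ℂ] H) x‖ ^ 2 := by
      refine div_le_of_le_mul₀ (by positivity) (by positivity) ?_
      have h := hπ t ((π t⁻¹ : H →L[ℂ] H) x)
      rw [← mul_apply_eq_comp, ← Units.val_mul, ← map_mul, mul_inv_cancel, map_one,
        Units.val_one, one_apply_eq_self] at h
      calc ‖x‖ ^ 2 ≤ (C * ‖(π t⁻¹ : H →L[ℂ] H) x‖) ^ 2 := by gcongr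
        _ = _ := by ring
    have hup (t : G) : ‖(π t⁻¹ : H →L[ℂ] H) x‖ ^ 2 ≤ C ^ 2 * ‖x‖ ^ 2 := by
      rw [← mul_pow]
      gcongr
      exact hπ _ _
    obtain ⟨r, hr, h₁, h₂⟩ := hreal _ _ _ hlow hup
    refine ⟨r, ?_, ?_, h₂⟩
    · rw [← hr]
      congr 1
      ext t
      simp [F]
    · rcases hC0.eq_or_lt with rfl | hC0
      · have h := hπ 1 x
        simp only [map_one, Units.val_one, one_apply_eq_self, zero_mul] at h
        simp [le_antisymm h (norm_nonneg x)]
      · rwa [div_le_iff₀' (by positivity)] at h₁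
  · rw [hB, hB, ← hinv g _ (bF x y)]
    congr 1
    ext t
    simp [F]

/-- **Day–Dixmier theorem.**  If `G` is an amenable discrete group and
`π : G → B(H)` is a uniformly bounded representation on a complex Hilbert space `H`,
then there is an invertible `S ∈ B(H)` with `‖S‖ ‖S⁻¹‖ ≤ |π|²` such that
`t ↦ S⁻¹ π(t) S` is a unitary representation.  In particular every amenable
discrete group is unitarizable. -/
theorem statement0 (G : Type*) [Group G] (hG : IsAmenable G)
    (H : Type*) [NormedAddCommGroup H] [InnerProductSpace ℂ H] [CompleteSpace H]
    (π : G →* (H →L[ℂ] H)ˣ)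
    (hb : ∃ C : ℝ, ∀ g : G, ‖(π g : H →L[ℂ] H)‖ ≤ C) :
    ∃ S : (H →L[ℂ] H)ˣ,
      ‖(S : H →L[ℂ] H)‖ * ‖((S⁻¹ : (H →L[ℂ] H)ˣ) : H →L[ℂ] H)‖ ≤
        (⨆ g : G, ‖(π g : H →L[ℂ] H)‖) ^ 2 ∧
      ∀ g : G, ((S⁻¹ * π g * S : (H →L[ℂ] H)ˣ) : H →L[ℂ] H) ∈ unitary (H →L[ℂ] H) := by
  set C := ⨆ g : G, ‖(π g : H →L[ℂ] H)‖
  have hC (g : G) : ‖(π g : H →L[ℂ] H)‖ ≤ C :=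
    le_ciSup (f := fun g => ‖(π g : H →L[ℂ] H)‖)
      (hb.imp fun _ h => Set.forall_mem_range.2 h) g
  have hC0 : 0 ≤ C := (norm_nonneg _).trans (hC 1)
  obtain ⟨T, hT, hinv⟩ := hG.exists_invariant_form π hC
  have hTpos : 0 ≤ T := by
    rw [ContinuousLinearMap.nonneg_iff_isPositive, ContinuousLinearMap.isPositive_iff_complex]
    intro x
    obtain ⟨r, hr, h₁, -⟩ := hT x
    rw [hr]
    refine ⟨by simp, ?_⟩
    rw [RCLike.re_to_complex, Complex.ofReal_re]
    rcases eq_or_ne x 0 with rfl | hx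
    · rw [inner_zero_right, eq_comm, Complex.ofReal_eq_zero] at hr
      exact hr.ge
    · exact (pos_of_mul_pos_right (lt_of_lt_of_le (by positivity) h₁) (sq_nonneg C)).le
  have hTunit : IsUnit T := by
    have hc : 0 < C ^ 2 + 1 := by positivity
    refine T.isUnit_of_forall_le_norm_inner_map (c := ⟨(C ^ 2 + 1)⁻¹, by positivity⟩)
      (by exact inv_pos.2 hc) fun x => ?_
    obtain ⟨r, hr, h₁, -⟩ := hT x
    rw [hr, Complex.norm_real, Real.norm_eq_abs]
    change ‖x‖ ^ 2 * (C ^ 2 + 1)⁻¹ ≤ |r|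
    rw [← div_eq_mul_inv, div_le_iff₀ hc]
    nlinarith [le_abs_self r, abs_nonneg r, sq_nonneg C]
  obtain ⟨R, hR⟩ := (CFC.isUnit_sqrt_iff T).2 hTunit
  have hRR : (R : H →L[ℂ] H) * R = T := by rw [hR, CFC.sqrt_mul_sqrt_self T]
  have hRsa : star (R : H →L[ℂ] H) = R := by
    rw [hR]
    exact (IsSelfAdjoint.of_nonneg (CFC.sqrt_nonneg T)).star_eq
  have hRnorm (x : H) : ((‖(R : H →L[ℂ] H) x‖ ^ 2 : ℝ) : ℂ) = ⟪T x, x⟫_ℂ := by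
    rw [← hRR, mul_apply_eq_comp, ← ContinuousLinearMap.adjoint_inner_right,
      ← ContinuousLinearMap.star_eq_adjoint, hRsa, inner_self_eq_norm_sq_to_K]
    simp
  refine ⟨R⁻¹, ?_, fun g => ?_⟩
  · rw [inv_inv, sq]
    refine mul_le_mul ?_ ?_ (norm_nonneg _) hC0
    · refine ContinuousLinearMap.opNorm_le_bound _ hC0 fun x => ?_
      obtain ⟨r, hr, h₁, -⟩ := hT (((R⁻¹ : (H →L[ℂ] H)ˣ) : H →L[ℂ] H) x)
      rw [← hRnorm, Complex.ofReal_inj, ← mul_apply_eq_comp, Units.mul_inv,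
        one_apply_eq_self] at hr
      rw [← hr, ← mul_pow] at h₁
      exact le_of_sq_le_sq h₁ (by positivity)
    · refine ContinuousLinearMap.opNorm_le_bound _ hC0 fun x => ?_
      obtain ⟨r, hr, -, h₂⟩ := hT x
      rw [← hRnorm, Complex.ofReal_inj] at hr
      rw [← hr, ← mul_pow] at h₂
      exact le_of_sq_le_sq h₂ (by positivity)
  · have hTπ : star (π g : H →L[ℂ] H) * T * π g = T := by
      ext x
      refine ext_inner_right ℂ fun y => ?_
      rw [← hinv g x y, mul_apply_eq_comp, mul_apply_eq_comp,
        ContinuousLinearMap.star_eq_adjoint, ContinuousLinearMap.adjoint_inner_left]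
    have hRinv : star ((R⁻¹ : (H →L[ℂ] H)ˣ) : H →L[ℂ] H) = (R⁻¹ : (H →L[ℂ] H)ˣ) := by
      have : star R = R := Units.ext hRsa
      rw [← Units.coe_star, star_inv, this]
    refine (IsUnit.mem_unitary_iff_star_mul_self (Units.isUnit _)).2 ?_
    simp only [inv_inv, Units.val_mul, star_mul, hRsa, hRinv]
    calc _ = ((R⁻¹ : (H →L[ℂ] H)ˣ) : H →L[ℂ] H) *
          (star (π g : H →L[ℂ] H) * ((R : H →L[ℂ] H) * R) * π g) *
          ((R⁻¹ : (H →L[ℂ] H)ˣ) : H →L[ℂ] H) := by simp only [mul_assoc]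
      _ = _ := by
        rw [hRR, hTπ, ← hRR, ← mul_assoc, Units.inv_mul, one_mul, Units.mul_inv]
end

section
/- Let Γ = F₂ be the free group on two generators and let λ: Γ → B(ℓ²(Γ)) be its left regular representation. Then there exists a bounded λ-derivation D: Γ → B(ℓ²(Γ)) that is not inner. (Equivalently, the first bounded cohomology H¹_b(Γ, B(ℓ²Γ)) with respect to the conjugation action γ·T = λ(γ)Tλ(γ)⁻¹ is nonzero.) -/
open scoped ENNReal

/-! ### Operators on `ℓ²` induced by partial injections -/

namespace lp

variable {ι : Type*}

/-- A function on `ι`, extended by zero to `Option ι`. -/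
def extendOption (ξ : ι → ℂ) : Option ι → ℂ
  | none => 0
  | some y => ξ y

theorem sum_extendOption_le {q : ι → Option ι} (hq : ∀ x x' y, q x = some y → q x' = some y → x = x')
    (ξ : lp (fun _ : ι => ℂ) 2) (s : Finset ι) :
    ∑ x ∈ s, ‖extendOption ξ (q x)‖ ^ (2 : ℝ≥0∞).toReal ≤ ‖ξ‖ ^ (2 : ℝ≥0∞).toReal := by
  classical
  refine le_trans (le_of_eq ?_) (lp.sum_rpow_le_norm_rpow (by simp) ξ
    (s.filterMap q fun a a' b h h' => hq a a' b h h'))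
  refine Finset.sum_bij_ne_zero (fun x _ h => (q x).get ?_) ?_ ?_ ?_ ?_
  · rw [Option.isSome_iff_ne_none]
    intro h0
    simp [h0, extendOption] at h
  · intro x hx h
    exact (Finset.mem_filterMap _).2 ⟨x, hx, by simp⟩
  · intro x hx h x' hx' h' e
    exact hq x x' _ (Option.some_get _).symm (by rw [e]; simp)
  · intro y hy h
    obtain ⟨x, hx, e⟩ := (Finset.mem_filterMap _).1 hy
    exact ⟨x, hx, by simpa [e, extendOption] using h, by simp [e]⟩
  · intro x hx h
    have : ∀ (o : Option ι) (ho : o.isSome), extendOption ξ o = ξ (o.get ho) := by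
      rintro (_ | y) ho
      · simp at ho
      · rfl
    rw [← this]

/-- Composition with a partial injection, as an operator on `ℓ²`. -/
noncomputable def compPartial (q : ι → Option ι)
    (hq : ∀ x x' y, q x = some y → q x' = some y → x = x') :
    lp (fun _ : ι => ℂ) 2 →L[ℂ] lp (fun _ : ι => ℂ) 2 :=
  LinearMap.mkContinuous
    { toFun := fun ξ => ⟨fun x => extendOption ξ (q x), memℓp_gen' (sum_extendOption_le hq ξ)⟩
      map_add' := fun ξ η => by
        ext x
        change extendOption _ (q x) = extendOption _ (q x) + extendOption _ (q x)
        cases q x <;> simp [extendOption]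
      map_smul' := fun c ξ => by
        ext x
        change extendOption _ (q x) = c * extendOption _ (q x)
        cases q x <;> simp [extendOption] }
    1 fun ξ => by
      rw [one_mul]
      exact lp.norm_le_of_forall_sum_le (by simp) (norm_nonneg _) (sum_extendOption_le hq ξ)

theorem compPartial_apply (q : ι → Option ι)
    (hq : ∀ x x' y, q x = some y → q x' = some y → x = x')
    (ξ : lp (fun _ : ι => ℂ) 2) (x : ι) :
    (compPartial q hq ξ : ι → ℂ) x = extendOption ξ (q x) := rfl

theorem norm_compPartial_le (q : ι → Option ι)
    (hq : ∀ x x' y, q x = some y → q x' = some y → x = x') : ‖compPartial q hq‖ ≤ 1 :=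
  LinearMap.mkContinuous_norm_le _ zero_le_one _

theorem tendsto_cofinite_zero (ξ : lp (fun _ : ι => ℂ) 2) :
    Filter.Tendsto (ξ : ι → ℂ) Filter.cofinite (nhds 0) := by
  have h := ((lp.memℓp ξ).summable (by simp)).tendsto_cofinite_zero
  rw [tendsto_zero_iff_norm_tendsto_zero]
  simpa using h.sqrt

end lp

/-! ### Deleting the last occurrence of a generator from a word -/

namespace FreeGroup

variable {α : Type*} [DecidableEq α] (t : α)

/-- Delete the last letter `t` or `t⁻¹` of a word, if there is one. -/
def eraseLast : List (α × Bool) → Option (List (α × Bool))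
  | [] => none
  | l :: w => match eraseLast w with
    | some v => some (l :: v)
    | none => if l.1 = t then some w else none

theorem eraseLast_eq_none {w : List (α × Bool)} : eraseLast t w = none ↔ ∀ l ∈ w, l.1 ≠ t := by
  induction w with
  | nil => simp [eraseLast]
  | cons l w ih =>
    cases h : eraseLast t w with
    | some v =>
      have : ¬ ∀ l ∈ w, l.1 ≠ t := fun h' => by simp [ih.2 h'] at h
      simp only [eraseLast, h, List.mem_cons, forall_eq_or_imp]
      simp only [reduceCtorEq, false_iff]
      tauto
    | none =>
      have := ih.1 h
      simp only [eraseLast, h, List.mem_cons, forall_eq_or_imp]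
      simp only [ite_eq_right_iff, reduceCtorEq, imp_false]
      tauto

theorem exists_of_eraseLast_eq_some {w v : List (α × Bool)} (h : eraseLast t w = some v) :
    ∃ y l z, w = y ++ l :: z ∧ l.1 = t ∧ (∀ m ∈ z, m.1 ≠ t) ∧ v = y ++ z := by
  induction w generalizing v with
  | nil => simp [eraseLast] at h
  | cons l w ih =>
    cases h' : eraseLast t w with
    | some u =>
      simp only [eraseLast, h', Option.some.injEq] at h
      obtain ⟨y, m, z, rfl, h1, h2, rfl⟩ := ih h'
      exact ⟨l :: y, m, z, rfl, h1, h2, h.symm⟩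
    | none =>
      simp only [eraseLast, h'] at h
      split_ifs at h with hl
      exact ⟨[], l, w, rfl, hl, (eraseLast_eq_none t).1 h', by simpa using h.symm⟩

theorem eraseLast_append {w v : List (α × Bool)} (u : List (α × Bool))
    (h : eraseLast t w = some v) : eraseLast t (u ++ w) = some (u ++ v) := by
  induction u with
  | nil => simpa
  | cons l u ih => simp [eraseLast, ih]

/-- The parent of an element of the free group: delete the last `t` or `t⁻¹` of its reduced word. -/
def parent (x : FreeGroup α) : Option (FreeGroup α) :=
  (eraseLast t x.toWord).map mk

variable {t}

theorem exists_common_prefix (g w : List (α × Bool)) :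
    ∃ u v z, g = u ++ v ∧ w = u ++ z ∧ ∀ a ∈ v.head?, ∀ b ∈ z.head?, a ≠ b := by
  induction g generalizing w with
  | nil => exact ⟨[], [], w, rfl, rfl, by simp⟩
  | cons a g ih =>
    cases w with
    | nil => exact ⟨[], a :: g, [], rfl, rfl, by simp⟩
    | cons b w =>
      by_cases hab : a = b
      · subst hab
        obtain ⟨u, v, z, rfl, rfl, h⟩ := ih w
        exact ⟨a :: u, v, z, rfl, rfl, h⟩
      · exact ⟨[], a :: g, b :: w, rfl, rfl, by simpa using hab⟩

theorem isReduced_invRev {v : List (α × Bool)} (hv : IsReduced v) : IsReduced (invRev v) := by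
  rw [isReduced_iff_reduce_eq] at *
  rw [reduce_invRev, hv]

theorem isReduced_invRev_append {v z : List (α × Bool)} (hv : IsReduced v) (hz : IsReduced z)
    (h : ∀ a ∈ v.head?, ∀ b ∈ z.head?, a ≠ b) : IsReduced (invRev v ++ z) := by
  refine List.isChain_append.2 ⟨isReduced_invRev hv, hz, ?_⟩
  intro a ha b hb
  cases v with
  | nil => simp at ha
  | cons c v =>
    have ha' : (c.1, !c.2) = a := by simpa [invRev] using ha
    subst ha'
    have hcb := h c (by simp) b hb
    rintro h1
    by_contra h2
    refine hcb (Prod.ext h1 ?_)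
    revert h2
    dsimp only
    cases c.2 <;> cases b.2 <;> simp

/-- If taking parents does not commute with `γ⁻¹` at `x`, then the part of `x` up to the last `t`
is a prefix of `γ`. -/
theorem prefix_of_parent_ne {γ x : FreeGroup α}
    (h : parent t (γ⁻¹ * x) ≠ (parent t x).map (γ⁻¹ * ·))
    {y : List (α × Bool)} {l : α × Bool} {z : List (α × Bool)} (hx : x.toWord = y ++ l :: z)
    (hl : l.1 = t) : y ++ [l] <+: γ.toWord := by
  obtain ⟨u, v, w, hγ, hxw, huv⟩ := exists_common_prefix γ.toWord x.toWord
  have hγr : IsReduced (u ++ v) := hγ ▸ isReduced_toWord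
  have hxr : IsReduced (u ++ w) := hxw ▸ isReduced_toWord
  have hred : IsReduced (invRev v ++ w) := isReduced_invRev_append
    (hγr.infix (List.suffix_append u v).isInfix) (hxr.infix (List.suffix_append u w).isInfix) huv
  have hγ' : γ = mk u * mk v := by rw [mul_mk, ← hγ, mk_toWord]
  have hx' : x = mk u * mk w := by rw [mul_mk, ← hxw, mk_toWord]
  have hprod : (γ⁻¹ * x).toWord = invRev v ++ w := by
    rw [← hred.reduce_eq, ← toWord_mk, ← mul_mk, ← inv_mk, hγ', hx']
    group
  cases hw : eraseLast t w with
  | some s =>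
    refine absurd ?_ h
    rw [parent, parent, hprod, hxw, eraseLast_append t _ hw, eraseLast_append t _ hw]
    simp only [Option.map_some, Option.some.injEq]
    rw [hγ', ← mul_mk, ← mul_mk, ← inv_mk]
    group
  | none =>
    rw [eraseLast_eq_none] at hw
    rw [hγ]
    rcases List.append_eq_append_iff.1 (hx.symm.trans hxw) with ⟨a, rfl, ha⟩ | ⟨b, rfl, hb⟩
    · cases a with
      | nil => exact absurd hl (hw l (by rw [← List.nil_append w, ← ha]; simp))
      | cons m a =>
        obtain ⟨rfl, -⟩ := List.cons.inj ha
        exact ⟨a ++ v, by simp⟩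
    · exact absurd hl (hw l (by rw [hb]; simp))

theorem reduce_forall_ne {w : List (α × Bool)} (hw : ∀ l ∈ w, l.1 ≠ t) :
    ∀ l ∈ reduce w, l.1 ≠ t := fun l hl => hw l (reduce.red.sublist.subset hl)

theorem eq_of_prefix_of_parent_eq {y y' z z' : List (α × Bool)} {l l' : α × Bool}
    {g : List (α × Bool)} (hg : IsReduced g) (hy : y ++ [l] <+: g) (hy' : y' ++ [l'] <+: g)
    (hl : l.1 = t) (hz : ∀ m ∈ z, m.1 ≠ t) (hz' : ∀ m ∈ z', m.1 ≠ t)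
    (hlen : y.length ≤ y'.length)
    (h : mk (y ++ z) = mk (y' ++ z')) : mk (y ++ l :: z) = mk (y' ++ l' :: z') := by
  have hp : y ++ [l] <+: y' ++ [l'] := List.prefix_of_prefix_length_le hy hy' (by simpa)
  rcases List.prefix_concat_iff.1 hp with he | he
  · obtain ⟨rfl, he⟩ := List.append_inj' he rfl
    obtain rfl : l = l' := by simpa using he
    have : mk z = mk z' := by simpa [← mul_mk] using h
    rw [← List.singleton_append, ← List.singleton_append (l := z')]
    simp only [← mul_mk, this]
  · obtain ⟨r, rfl⟩ := he
    have hr : IsReduced (l :: r) := hg.infix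
      (((List.infix_append y (l :: r) [l'])).trans (by simpa using hy'.isInfix))
    have e : mk (l :: r) = mk (z ++ invRev z') := by
      simp only [List.append_assoc, List.singleton_append, ← mul_mk, mul_right_inj] at h
      rw [← mul_mk, ← inv_mk, h]
      rw [← List.singleton_append, ← mul_mk]
      group
    have e' : l :: r = reduce (z ++ invRev z') := by
      rw [← toWord_mk, ← e, toWord_mk, hr.reduce_eq]
    refine absurd hl (reduce_forall_ne (w := z ++ invRev z') ?_ l (by rw [← e']; simp))
    intro m hm
    rcases List.mem_append.1 hm with hm | hm
    · exact hz m hm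
    · simp only [invRev, List.mem_reverse, List.mem_map] at hm
      obtain ⟨k, hk, rfl⟩ := hm
      exact hz' k hk

/-- Taking parents is injective where it does not commute with `γ⁻¹`. -/
theorem parent_injective_of_ne {γ x x' y : FreeGroup α}
    (h : parent t (γ⁻¹ * x) ≠ (parent t x).map (γ⁻¹ * ·))
    (h' : parent t (γ⁻¹ * x') ≠ (parent t x').map (γ⁻¹ * ·))
    (hx : parent t x = some y) (hx' : parent t x' = some y) : x = x' := by
  obtain ⟨v, hv, e⟩ := Option.map_eq_some_iff.1 hx
  obtain ⟨v', hv', e'⟩ := Option.map_eq_some_iff.1 hx'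
  obtain ⟨u, l, z, hw, hl, hz, rfl⟩ := exists_of_eraseLast_eq_some t hv
  obtain ⟨u', l', z', hw', hl', hz', rfl⟩ := exists_of_eraseLast_eq_some t hv'
  have hp := prefix_of_parent_ne h hw hl
  have hp' := prefix_of_parent_ne h' hw' hl'
  rw [← mk_toWord (x := x), ← mk_toWord (x := x'), hw, hw']
  rcases le_total u.length u'.length with hle | hle
  · exact eq_of_prefix_of_parent_eq isReduced_toWord hp hp' hl hz hz' hle (e.trans e'.symm)
  · exact (eq_of_prefix_of_parent_eq isReduced_toWord hp' hp hl' hz' hz hle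
      (e'.trans e.symm)).symm

variable (t) in
open Classical in
/-- `parent t x` translated by `γ⁻¹`, where this differs from `parent t (γ⁻¹ * x)`. -/
noncomputable def translatedParent (γ x : FreeGroup α) : Option (FreeGroup α) :=
  if parent t (γ⁻¹ * x) = (parent t x).map (γ⁻¹ * ·) then none else (parent t x).map (γ⁻¹ * ·)

variable (t) in
open Classical in
/-- `parent t (γ⁻¹ * x)`, where this differs from the translate of `parent t x` by `γ⁻¹`. -/
noncomputable def parentTranslated (γ x : FreeGroup α) : Option (FreeGroup α) :=
  if parent t (γ⁻¹ * x) = (parent t x).map (γ⁻¹ * ·) then none else parent t (γ⁻¹ * x)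

theorem translatedParent_injective (γ x x' y : FreeGroup α)
    (hx : translatedParent t γ x = some y) (hx' : translatedParent t γ x' = some y) : x = x' := by
  unfold translatedParent at hx hx'
  split_ifs at hx hx' with h h'
  obtain ⟨p, hp, e⟩ := Option.map_eq_some_iff.1 hx
  obtain ⟨p', hp', e'⟩ := Option.map_eq_some_iff.1 hx'
  obtain rfl : p = p' := mul_left_cancel (e.trans e'.symm)
  exact parent_injective_of_ne h h' hp hp'

theorem parentTranslated_injective (γ x x' y : FreeGroup α)
    (hx : parentTranslated t γ x = some y) (hx' : parentTranslated t γ x' = some y) : x = x' := by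
  unfold parentTranslated at hx hx'
  split_ifs at hx hx' with h h'
  have key : ∀ x, parent t (γ⁻¹ * x) ≠ (parent t x).map (γ⁻¹ * ·) →
      parent t (γ⁻¹⁻¹ * (γ⁻¹ * x)) ≠ (parent t (γ⁻¹ * x)).map (γ⁻¹⁻¹ * ·) := by
    intro x h h0
    refine h ?_
    rw [inv_inv, mul_inv_cancel_left] at h0
    rw [h0]
    simp [Function.comp_def]
  exact mul_left_cancel (parent_injective_of_ne (key x h) (key x' h') hx hx')

theorem extendOption_parentTranslated_sub (ξ : FreeGroup α → ℂ) (γ x : FreeGroup α) :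
    lp.extendOption ξ (parentTranslated t γ x) - lp.extendOption ξ (translatedParent t γ x) =
      lp.extendOption ξ (parent t (γ⁻¹ * x)) -
        lp.extendOption (fun y => ξ (γ⁻¹ * y)) (parent t x) := by
  have : lp.extendOption (fun y => ξ (γ⁻¹ * y)) (parent t x) =
      lp.extendOption ξ ((parent t x).map (γ⁻¹ * ·)) := by
    cases parent t x <;> rfl
  rw [this]
  unfold parentTranslated translatedParent
  split_ifs with h
  · rw [h]; simp
  · rfl

variable (t) in
/-- The commutator of the left translation by `γ` with the (unbounded) operator of composition
with `parent t`. -/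
noncomputable def parentDerivation (γ : FreeGroup α) :
    lp (fun _ : FreeGroup α => ℂ) 2 →L[ℂ] lp (fun _ : FreeGroup α => ℂ) 2 :=
  lp.compPartial (parentTranslated t γ) (parentTranslated_injective γ) -
    lp.compPartial (translatedParent t γ) (translatedParent_injective γ)

theorem parentDerivation_apply (γ : FreeGroup α) (ξ : lp (fun _ : FreeGroup α => ℂ) 2)
    (x : FreeGroup α) : (parentDerivation t γ ξ : FreeGroup α → ℂ) x =
      lp.extendOption ξ (parent t (γ⁻¹ * x)) -
        lp.extendOption (fun y => ξ (γ⁻¹ * y)) (parent t x) := by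
  rw [← extendOption_parentTranslated_sub]
  rfl

theorem norm_parentDerivation_le (γ : FreeGroup α) : ‖parentDerivation t γ‖ ≤ 2 :=
  (norm_sub_le _ _).trans (by
    linarith [lp.norm_compPartial_le (parentTranslated t γ) (parentTranslated_injective γ),
      lp.norm_compPartial_le (translatedParent t γ) (translatedParent_injective γ)])

theorem parent_one : parent t (1 : FreeGroup α) = none := by simp [parent, eraseLast]

theorem toWord_conj {a t : α} (h : a ≠ t) (n : ℕ) :
    (of a ^ n * of t * (of a ^ n)⁻¹).toWord =
      List.replicate n (a, true) ++ (t, true) :: List.replicate n (a, false) := by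
  have hr : ∀ b, IsReduced (List.replicate n (a, b)) := fun b =>
    List.isChain_replicate_of_rel n (fun _ => rfl)
  have : IsReduced
      (List.replicate n (a, true) ++ (t, true) :: List.replicate n (a, false)) := by
    refine List.isChain_append.2 ⟨hr _, List.isChain_cons.2 ⟨?_, hr _⟩, ?_⟩
    · intro y hy
      obtain rfl := List.eq_of_mem_replicate (List.mem_of_mem_head? hy)
      exact fun h' => absurd h'.symm h
    · intro y hy
      obtain rfl := List.eq_of_mem_replicate (List.mem_of_mem_getLast? hy)
      simp
  rw [← this.reduce_eq, ← toWord_mk]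
  congr 1
  rw [← List.singleton_append, ← mul_mk, ← mul_mk, ← mk_toWord (x := of a ^ n), toWord_of_pow,
    inv_mk, mul_assoc]
  simp [invRev, of]

theorem parent_conj {a t : α} (h : a ≠ t) (n : ℕ) :
    parent t (of a ^ n * of t * (of a ^ n)⁻¹) = some 1 := by
  have h1 : eraseLast t (List.replicate n (a, false)) = none :=
    (eraseLast_eq_none t).2 fun l hl => by rwa [List.eq_of_mem_replicate hl]
  have h2 : eraseLast t ((t, true) :: List.replicate n (a, false)) =
      some (List.replicate n (a, false)) := by simp [eraseLast, h1]
  rw [parent, toWord_conj h, eraseLast_append t _ h2, Option.map_some, ← mul_mk]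
  have : List.replicate n (a, false) = invRev (List.replicate n (a, true)) := by simp [invRev]
  rw [this, ← inv_mk, mul_inv_cancel]

theorem conj_injective {a t : α} (h : a ≠ t) :
    Function.Injective fun n : ℕ => of a ^ n * of t * (of a ^ n)⁻¹ := by
  intro n m e
  have := congrArg (fun x => x.toWord.length) e
  simp only [toWord_conj h, List.length_append, List.length_cons, List.length_replicate] at this
  omega

end FreeGroup

/-- **(Non-vanishing of bounded cohomology for `F₂`.)**
Let `Γ = F₂` and let `lam` be the left regular representation of `Γ` on `ℓ²(Γ)`,
i.e. `(lam γ ξ) t = ξ (γ⁻¹ t)`.  Then there is a bounded `lam`-derivation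
`D : Γ → B(ℓ²Γ)` that is not inner.  (Equivalently `H¹_b(Γ, B(ℓ²Γ)) ≠ 0` for the
conjugation action.) -/
theorem statement1
    (lam : FreeGroup (Fin 2) →
      (lp (fun _ : FreeGroup (Fin 2) => ℂ) 2 →L[ℂ] lp (fun _ : FreeGroup (Fin 2) => ℂ) 2))
    (hlam_unitary : ∀ γ, lam γ ∈ unitary
      (lp (fun _ : FreeGroup (Fin 2) => ℂ) 2 →L[ℂ] lp (fun _ : FreeGroup (Fin 2) => ℂ) 2))
    (hlam : ∀ (γ : FreeGroup (Fin 2)) (ξ : lp (fun _ : FreeGroup (Fin 2) => ℂ) 2)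
      (t : FreeGroup (Fin 2)),
      (lam γ ξ : ∀ _ : FreeGroup (Fin 2), ℂ) t = (ξ : ∀ _ : FreeGroup (Fin 2), ℂ) (γ⁻¹ * t)) :
    ∃ D : FreeGroup (Fin 2) →
      (lp (fun _ : FreeGroup (Fin 2) => ℂ) 2 →L[ℂ] lp (fun _ : FreeGroup (Fin 2) => ℂ) 2),
      (∀ s t, D (s * t) = lam s * D t + D s * lam t) ∧
      (∃ C : ℝ, ∀ t, ‖D t‖ ≤ C) ∧
      ¬ ∃ T, ∀ t, D t = lam t * T - T * lam t := by
  refine ⟨FreeGroup.parentDerivation 1, ?_, ⟨2, FreeGroup.norm_parentDerivation_le⟩, ?_⟩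
  · intro s t
    ext ξ x
    change (FreeGroup.parentDerivation 1 (s * t) ξ : FreeGroup (Fin 2) → ℂ) x =
      (lam s (FreeGroup.parentDerivation 1 t ξ) : FreeGroup (Fin 2) → ℂ) x +
        (FreeGroup.parentDerivation 1 s (lam t ξ) : FreeGroup (Fin 2) → ℂ) x
    have h : ((lam t ξ : lp _ 2) : FreeGroup (Fin 2) → ℂ) = fun y => ξ (t⁻¹ * y) :=
      funext (hlam t ξ)
    simp only [hlam, FreeGroup.parentDerivation_apply, h, mul_inv_rev, mul_assoc]
    ring
  · rintro ⟨T, hT⟩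
    set g : ℕ → FreeGroup (Fin 2) := fun n =>
      FreeGroup.of 0 ^ n * FreeGroup.of 1 * (FreeGroup.of 0 ^ n)⁻¹ with hg
    have hginj : Function.Injective g := FreeGroup.conj_injective (by decide)
    set e : FreeGroup (Fin 2) → lp (fun _ : FreeGroup (Fin 2) => ℂ) 2 := fun x =>
      lp.single 2 x (1 : ℂ) with he
    have hcoef : ∀ n, (T (e (g n)⁻¹) : FreeGroup (Fin 2) → ℂ) 1 -
        (T (e 1) : FreeGroup (Fin 2) → ℂ) (g n) = -1 := by
      intro n
      have hlame : lam (g n) (e (g n)⁻¹) = e 1 := by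
        ext x
        rw [hlam]
        simp only [he, lp.single_apply, Pi.single_apply]
        simp
      have h := congrArg (fun S => (S (e (g n)⁻¹) : FreeGroup (Fin 2) → ℂ) (g n)) (hT (g n))
      change (FreeGroup.parentDerivation 1 (g n) (e (g n)⁻¹) : FreeGroup (Fin 2) → ℂ) (g n) =
        (lam (g n) (T (e (g n)⁻¹)) : FreeGroup (Fin 2) → ℂ) (g n) -
          (T (lam (g n) (e (g n)⁻¹)) : FreeGroup (Fin 2) → ℂ) (g n) at h
      rw [hlame, hlam, inv_mul_cancel, FreeGroup.parentDerivation_apply, inv_mul_cancel,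
        FreeGroup.parent_one, FreeGroup.parent_conj (by decide)] at h
      rw [← h]
      simp [lp.extendOption, he]
    have h1 : Filter.Tendsto (fun n => (T (e 1) : FreeGroup (Fin 2) → ℂ) (g n)) Filter.atTop
        (nhds 0) := by
      rw [← Nat.cofinite_eq_atTop]
      exact (lp.tendsto_cofinite_zero (T (e 1))).comp hginj.tendsto_cofinite
    have h2 : Filter.Tendsto (fun n => (T (e (g n)⁻¹) : FreeGroup (Fin 2) → ℂ) 1) Filter.atTop
        (nhds 0) := by
      have hadj : ∀ x, (T (e x) : FreeGroup (Fin 2) → ℂ) 1 =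
          star ((ContinuousLinearMap.adjoint T (e 1) : FreeGroup (Fin 2) → ℂ) x) := by
        intro x
        have h := ContinuousLinearMap.adjoint_inner_right T (e x) (e 1)
        simp only [he, lp.inner_single_left, lp.inner_single_right] at h ⊢
        simpa using congrArg star h.symm
      simp only [hadj]
      rw [← Nat.cofinite_eq_atTop, ← star_zero ℂ]
      exact ((lp.tendsto_cofinite_zero (ContinuousLinearMap.adjoint T (e 1))).comp
        (inv_injective.comp hginj).tendsto_cofinite).star
    have h3 := h2.sub h1
    simp only [hcoef, sub_zero] at h3
    have := tendsto_nhds_unique h3 tendsto_const_nhds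
    simp at this
end

section
/- Let G be a discrete group. Suppose there exist a complex Hilbert space H, a unitary representation σ: G → B(H), and a bounded σ-derivation D: G → B(H) that is not inner. Then G is not unitarizable; indeed, the map π(g) = [[σ(g), D(g)], [0, σ(g)]] (a 2×2 operator matrix acting on H ⊕ H) is a uniformly bounded representation of G that is not unitarizable. -/
open ContinuousLinearMap in
/-- If `W` has a bounded left inverse, then `W† W` is invertible. -/
theorem isUnit_adjoint_comp_self_of_leftInverse {H K : Type*}
    [NormedAddCommGroup H] [InnerProductSpace ℂ H] [CompleteSpace H]
    [NormedAddCommGroup K] [InnerProductSpace ℂ K] [CompleteSpace K]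
    (W : H →L[ℂ] K) (L : K →L[ℂ] H) (hLW : ∀ x, L (W x) = x) :
    IsUnit (adjoint W ∘L W) := by
  have hpos : (0 : ℝ) < ‖L‖ + 1 := by positivity
  refine isUnit_of_forall_le_norm_inner_map _
    (c := ⟨((‖L‖ + 1) ^ 2)⁻¹, by positivity⟩) (NNReal.coe_pos.mp ?_) fun x => ?_
  · change (0 : ℝ) < ((‖L‖ + 1) ^ 2)⁻¹
    positivity
  · have hx : ‖x‖ ≤ (‖L‖ + 1) * ‖W x‖ := by
      calc ‖x‖ = ‖L (W x)‖ := by rw [hLW]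
        _ ≤ ‖L‖ * ‖W x‖ := L.le_opNorm _
        _ ≤ (‖L‖ + 1) * ‖W x‖ := by gcongr; linarith
    have hinner : ‖inner ℂ ((adjoint W ∘L W) x) x‖ = ‖W x‖ ^ 2 := by
      rw [comp_apply, adjoint_inner_left, inner_self_eq_norm_sq_to_K]
      simp
    rw [hinner]
    change ‖x‖ ^ 2 * ((‖L‖ + 1) ^ 2)⁻¹ ≤ ‖W x‖ ^ 2
    rw [← div_eq_mul_inv, div_le_iff₀ (by positivity), ← mul_pow, mul_comm]
    gcongr

open ContinuousLinearMap in
/-- If the representation `[[σ, D], [0, σ]]`, given by coordinate maps `p₁, p₂ : K → H`,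
is similar to a unitary one, then `D` is inner. -/
theorem exists_eq_commutator_of_similar_unitary {G H K : Type*}
    [NormedAddCommGroup H] [InnerProductSpace ℂ H] [CompleteSpace H]
    [NormedAddCommGroup K] [InnerProductSpace ℂ K] [CompleteSpace K]
    (σ : G → unitary (H →L[ℂ] H)) (D : G → (H →L[ℂ] H)) (π : G → (K →L[ℂ] K))
    (p₁ p₂ : K →L[ℂ] H) (q : H →L[ℂ] K) (hq : p₂ ∘L q = ContinuousLinearMap.id ℂ H)
    (h₁ : ∀ g, p₁ ∘L π g = (σ g : H →L[ℂ] H) ∘L p₁ + D g ∘L p₂)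
    (h₂ : ∀ g, p₂ ∘L π g = (σ g : H →L[ℂ] H) ∘L p₂)
    (S : (K →L[ℂ] K)ˣ)
    (hS : ∀ g, (↑S⁻¹ : K →L[ℂ] K) * π g * (S : K →L[ℂ] K) ∈ unitary (K →L[ℂ] K)) :
    ∃ T : H →L[ℂ] H, ∀ g,
      D g = (σ g : H →L[ℂ] H) * T - T * (σ g : H →L[ℂ] H) := by
  set P : K →L[ℂ] K := (S : K →L[ℂ] K) * star (S : K →L[ℂ] K) with hP
  have hinv : ∀ g, π g * P * star (π g) = P := by
    intro g
    set U := (↑S⁻¹ : K →L[ℂ] K) * π g * (S : K →L[ℂ] K) with hU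
    have hSU : π g * (S : K →L[ℂ] K) = S * U := by
      rw [hU, mul_assoc, Units.mul_inv_cancel_left]
    calc π g * P * star (π g)
        = (π g * S) * star (π g * (S : K →L[ℂ] K)) := by rw [hP, star_mul]; simp only [mul_assoc]
      _ = S * (U * star U) * star (S : K →L[ℂ] K) := by
          rw [hSU, star_mul]; simp only [mul_assoc]
      _ = P := by rw [Unitary.mul_star_self_of_mem (hS g), mul_one]
  have hentry : ∀ (p : K →L[ℂ] H) (g : G),
      p ∘L P ∘L adjoint p₂ * (σ g : H →L[ℂ] H) = (p ∘L π g) ∘L P ∘L adjoint p₂ := by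
    intro p g
    have hadj : star (π g) ∘L adjoint p₂ = adjoint p₂ ∘L star (σ g : H →L[ℂ] H) := by
      have := congrArg adjoint (h₂ g)
      rwa [adjoint_comp, adjoint_comp] at this
    have hσ : star (σ g : H →L[ℂ] H) * (σ g : H →L[ℂ] H) = 1 := Unitary.coe_star_mul_self _
    calc p ∘L P ∘L adjoint p₂ * (σ g : H →L[ℂ] H)
        = p ∘L (π g * P * star (π g)) ∘L adjoint p₂ ∘L (σ g : H →L[ℂ] H) := by
          rw [hinv]; rfl
      _ = (p ∘L π g) ∘L P ∘L (star (π g) ∘L adjoint p₂) ∘L (σ g : H →L[ℂ] H) := rfl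
      _ = (p ∘L π g) ∘L P ∘L adjoint p₂ ∘L (star (σ g : H →L[ℂ] H) * (σ g : H →L[ℂ] H)) := by
          rw [hadj]; rfl
      _ = _ := by rw [hσ]; rfl
  set d : H →L[ℂ] H := p₂ ∘L P ∘L adjoint p₂ with hd
  set b : H →L[ℂ] H := p₁ ∘L P ∘L adjoint p₂ with hb
  have hdσ : ∀ g, d * (σ g : H →L[ℂ] H) = (σ g : H →L[ℂ] H) * d := by
    intro g
    rw [hd, hentry, h₂]
    rfl
  have hbσ : ∀ g, b * (σ g : H →L[ℂ] H) = (σ g : H →L[ℂ] H) * b + D g * d := by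
    intro g
    rw [hb, hentry, h₁, add_comp]
    rfl
  have hdu : IsUnit d := by
    have hL : ∀ x, (adjoint q ∘L star (↑S⁻¹ : K →L[ℂ] K))
        ((star (S : K →L[ℂ] K) ∘L adjoint p₂) x) = x := by
      intro x
      have h1 : star (↑S⁻¹ : K →L[ℂ] K) * star (S : K →L[ℂ] K) = 1 := by
        rw [← star_mul, Units.mul_inv, star_one]
      have h2 : adjoint q ∘L adjoint p₂ = ContinuousLinearMap.id ℂ H := by
        rw [← adjoint_comp, hq]
        exact star_one (H →L[ℂ] H)
      calc _ = adjoint q ((star (↑S⁻¹ : K →L[ℂ] K) * star (S : K →L[ℂ] K)) (adjoint p₂ x)) := rfl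
        _ = (adjoint q ∘L adjoint p₂) x := by rw [h1]; rfl
        _ = x := by rw [h2]; rfl
    have := isUnit_adjoint_comp_self_of_leftInverse _ _ hL
    rw [adjoint_comp, star_eq_adjoint, adjoint_adjoint, adjoint_adjoint] at this
    exact this
  obtain ⟨u, hu⟩ := hdu
  have huσ : ∀ g, (↑u⁻¹ : H →L[ℂ] H) * (σ g : H →L[ℂ] H) = (σ g : H →L[ℂ] H) * ↑u⁻¹ := by
    intro g
    have hc : Commute (u : H →L[ℂ] H) (σ g : H →L[ℂ] H) := by rw [hu]; exact hdσ g
    exact hc.units_inv_left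
  refine ⟨-(b * ↑u⁻¹), fun g => ?_⟩
  have hD : D g * d = b * (σ g : H →L[ℂ] H) - (σ g : H →L[ℂ] H) * b := by
    rw [hbσ, add_sub_cancel_left]
  calc D g = D g * d * ↑u⁻¹ := by rw [← hu, Units.mul_inv_cancel_right]
    _ = _ := by
      rw [hD, sub_mul, neg_mul, mul_neg, mul_assoc b, mul_assoc b, huσ, mul_assoc]
      abel


/-- A discrete group `G` is unitarizable if every uniformly bounded representation of `G`
on every complex Hilbert space is unitarizable. -/
def IsUnitarizableGroup (G : Type*) [Group G] : Prop :=
  ∀ (H : Type) [NormedAddCommGroup H] [InnerProductSpace ℂ H] [CompleteSpace H]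
    (π : G →* (H →L[ℂ] H)ˣ),
    (∃ C : ℝ, ∀ g : G, ‖(π g : H →L[ℂ] H)‖ ≤ C) →
    ∃ S : (H →L[ℂ] H)ˣ, ∀ g : G,
      ((S⁻¹ * π g * S : (H →L[ℂ] H)ˣ) : H →L[ℂ] H) ∈ unitary (H →L[ℂ] H)

/-- If a discrete group `G` carries a unitary representation `σ` on a complex Hilbert
space `H` together with a bounded `σ`-derivation `D` that is not inner, then `G` is not
unitarizable; indeed the operator-matrix representation
`π(g) = [[σ(g), D(g)], [0, σ(g)]]` on `H ⊕ H` is a uniformly bounded representation of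
`G` that is not unitarizable. -/
theorem statement2 (G : Type*) [Group G]
    (H : Type) [NormedAddCommGroup H] [InnerProductSpace ℂ H] [CompleteSpace H]
    (σ : G →* unitary (H →L[ℂ] H))
    (D : G → (H →L[ℂ] H))
    (hD : ∀ s t : G, D (s * t) = (σ s : H →L[ℂ] H) * D t + D s * (σ t : H →L[ℂ] H))
    (hDb : ∃ C : ℝ, ∀ t : G, ‖D t‖ ≤ C)
    (hDni : ¬ ∃ T : H →L[ℂ] H, ∀ t : G,
      D t = (σ t : H →L[ℂ] H) * T - T * (σ t : H →L[ℂ] H))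
    (π : G → (WithLp 2 (H × H) →L[ℂ] WithLp 2 (H × H)))
    (hπ : ∀ (g : G) (x : WithLp 2 (H × H)),
      WithLp.equiv 2 (H × H) (π g x) =
        ((σ g : H →L[ℂ] H) ((WithLp.equiv 2 (H × H)) x).1
            + D g ((WithLp.equiv 2 (H × H)) x).2,
         (σ g : H →L[ℂ] H) ((WithLp.equiv 2 (H × H)) x).2)) :
    π 1 = 1 ∧
    (∀ s t : G, π (s * t) = π s * π t) ∧
    (∀ g : G, IsUnit (π g)) ∧
    (∃ C : ℝ, ∀ g : G, ‖π g‖ ≤ C) ∧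
    ¬ (∃ S : (WithLp 2 (H × H) →L[ℂ] WithLp 2 (H × H))ˣ, ∀ g : G,
        ((S⁻¹ : (WithLp 2 (H × H) →L[ℂ] WithLp 2 (H × H))ˣ) : _) * π g * (S : _) ∈
          unitary (WithLp 2 (H × H) →L[ℂ] WithLp 2 (H × H))) ∧
    ¬ IsUnitarizableGroup G := by
  have hfst : ∀ g x, (π g x).fst = (σ g : H →L[ℂ] H) x.fst + D g x.snd :=
    fun g x => congrArg Prod.fst (hπ g x)
  have hsnd : ∀ g x, (π g x).snd = (σ g : H →L[ℂ] H) x.snd :=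
    fun g x => congrArg Prod.snd (hπ g x)
  have hext : ∀ x y : WithLp 2 (H × H), x.fst = y.fst → x.snd = y.snd → x = y :=
    fun x y h h' => (WithLp.equiv 2 (H × H)).injective (Prod.ext h h')
  have hD1 : D 1 = 0 := by
    have h := hD 1 1
    simpa using h
  have hone : π 1 = 1 := by
    ext1 x
    apply hext
    · rw [hfst, hD1, map_one]; simp
    · rw [hsnd, map_one]; simp
  have hmul : ∀ s t : G, π (s * t) = π s * π t := by
    intro s t
    ext1 x
    apply hext
    · rw [mul_apply_eq_comp, hfst, hfst, hfst, hsnd, hD, map_mul]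
      simp [add_assoc]
    · rw [mul_apply_eq_comp, hsnd, hsnd, hsnd, map_mul]
      simp
  let πh : G →* (WithLp 2 (H × H) →L[ℂ] WithLp 2 (H × H)) :=
    { toFun := π, map_one' := hone, map_mul' := hmul }
  have hbdd : ∃ C : ℝ, ∀ g : G, ‖π g‖ ≤ C := by
    obtain ⟨C, hC⟩ := hDb
    have hσ : ∀ g (x : H), ‖(σ g : H →L[ℂ] H) x‖ = ‖x‖ := fun g x =>
      ContinuousLinearMap.norm_map_of_mem_unitary (σ g).2 x
    have hC0 : 0 ≤ C := (norm_nonneg _).trans (hC 1)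
    refine ⟨1 + C + 1, fun g => ContinuousLinearMap.opNorm_le_bound _ (by positivity) fun x => ?_⟩
    have h1 : ‖x.fst‖ ≤ ‖x‖ := WithLp.norm_fst_le _ x
    have h2 : ‖x.snd‖ ≤ ‖x‖ := WithLp.norm_snd_le _ x
    have hsum : ∀ y : WithLp 2 (H × H), ‖y‖ ≤ ‖y.fst‖ + ‖y.snd‖ := fun y => by
      rw [WithLp.prod_norm_eq_of_L2]
      refine Real.sqrt_le_iff.mpr ⟨by positivity, ?_⟩
      nlinarith [norm_nonneg y.fst, norm_nonneg y.snd]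
    calc ‖π g x‖ ≤ ‖(π g x).fst‖ + ‖(π g x).snd‖ := hsum _
      _ ≤ (‖(σ g : H →L[ℂ] H) x.fst‖ + ‖D g x.snd‖) + ‖(σ g : H →L[ℂ] H) x.snd‖ := by
          rw [hfst, hsnd]; gcongr; exact norm_add_le _ _
      _ ≤ (‖x‖ + C * ‖x‖) + ‖x‖ := by
          rw [hσ, hσ]
          gcongr
          exact ((D g).le_of_opNorm_le (hC g) _).trans (by gcongr)
      _ = (1 + C + 1) * ‖x‖ := by ring
  have hnot : ¬ ∃ S : (WithLp 2 (H × H) →L[ℂ] WithLp 2 (H × H))ˣ, ∀ g : G,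
      (↑S⁻¹ : WithLp 2 (H × H) →L[ℂ] WithLp 2 (H × H)) * π g *
        (S : WithLp 2 (H × H) →L[ℂ] WithLp 2 (H × H)) ∈
          unitary (WithLp 2 (H × H) →L[ℂ] WithLp 2 (H × H)) := by
    rintro ⟨S, hS⟩
    refine hDni (exists_eq_commutator_of_similar_unitary σ D π
      (WithLp.fstL 2 ℂ H H) (WithLp.sndL 2 ℂ H H)
      ((WithLp.prodContinuousLinearEquiv 2 ℂ H H).symm.toContinuousLinearMap ∘L
        ContinuousLinearMap.inr ℂ H H) ?_ (fun g => ?_) (fun g => ?_) S hS)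
    · ext x; rfl
    · ext1 x; exact hfst g x
    · ext1 x; exact hsnd g x
  refine ⟨hone, hmul, fun g => (Group.isUnit g).map πh, hbdd, hnot, fun hG => hnot ?_⟩
  exact hG (WithLp 2 (H × H)) πh.toHomUnits hbdd
end

section
/- Let Γ be a countable group acting by measure-preserving transformations on a probability space (X,μ), let σ: Γ → B(H) be a unitary representation on a complex Hilbert space H, and let Γ act on B(H) by γ·b = σ(γ)bσ(γ)⁻¹. Let f: Γ×Γ → B(H) be a bounded map and suppose there exists an essentially bounded, Bochner-integrable function T: X → B(H) such that for all γ₀, γ₁ ∈ Γ and μ-almost every x ∈ X one has f(γ₀,γ₁) = γ₀·T(γ₀⁻¹x) − γ₁·T(γ₁⁻¹x). Then, setting T̂ = ∫_X T(x) dμ(x) ∈ B(H), one has f(γ₀,γ₁) = γ₀·T̂ − γ₁·T̂ for all γ₀,γ₁ ∈ Γ. (This expresses the injectivity of the natural map H¹_b(Γ, B(H)) → H¹_b(Γ, L_∞(X,μ;B(H))).) -/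
open MeasureTheory

/-- The action of `Γ` on `B(H)` by conjugation through a unitary representation `σ`:
`γ • b = σ(γ) b σ(γ)⁻¹`. -/
noncomputable def conjAct {Γ : Type*} [Group Γ] {H : Type*} [NormedAddCommGroup H]
    [InnerProductSpace ℂ H] [CompleteSpace H]
    (σ : Γ →* unitary (H →L[ℂ] H)) (γ : Γ) (T : H →L[ℂ] H) : H →L[ℂ] H :=
  (σ γ : H →L[ℂ] H) * T * (((σ γ)⁻¹ : unitary (H →L[ℂ] H)) : H →L[ℂ] H)

theorem MeasureTheory.MeasurePreserving.integral_comp_of_integrable {X Y E : Type*}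
    [MeasurableSpace X] [MeasurableSpace Y] {μ : Measure X} {ν : Measure Y}
    [NormedAddCommGroup E] [NormedSpace ℝ E] {g : X → Y} (hg : MeasurePreserving g μ ν)
    {T : Y → E} (hT : Integrable T ν) : ∫ x, T (g x) ∂μ = ∫ y, T y ∂ν := by
  have hT' : AEStronglyMeasurable T (μ.map g) := by
    rw [hg.map_eq]
    exact hT.aestronglyMeasurable
  rw [← integral_map hg.measurable.aemeasurable hT', hg.map_eq]

theorem integrable_and_integral_conjAct_comp {Γ X H : Type*} [Group Γ] [MeasurableSpace X]
    {μ : Measure X} [NormedAddCommGroup H] [InnerProductSpace ℂ H] [CompleteSpace H]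
    (σ : Γ →* unitary (H →L[ℂ] H)) (γ : Γ) {g : X → X} (hg : MeasurePreserving g μ μ)
    {T : X → (H →L[ℂ] H)} (hT : Integrable T μ) :
    Integrable (fun x => conjAct σ γ (T (g x))) μ ∧
      ∫ x, conjAct σ γ (T (g x)) ∂μ = conjAct σ γ (∫ x, T x ∂μ) := by
  let L : (H →L[ℂ] H) →L[ℂ] (H →L[ℂ] H) :=
    ContinuousLinearMap.mulLeftRight ℂ (H →L[ℂ] H) (σ γ : H →L[ℂ] H)
      (((σ γ)⁻¹ : unitary (H →L[ℂ] H)) : H →L[ℂ] H)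
  have hL : ∀ b, conjAct σ γ b = L b := fun _ => rfl
  have hTg : Integrable (fun x => T (g x)) μ := hg.integrable_comp_of_integrable hT
  simp only [hL]
  exact ⟨L.integrable_comp hTg, by
    rw [L.integral_comp_comm hTg, hg.integral_comp_of_integrable hT]⟩

/-- Injectivity of `H¹_b(Γ, B(H)) → H¹_b(Γ, L_∞(X,μ;B(H)))`: if the bounded cocycle
`f` is a coboundary of an essentially bounded integrable function `T : X → B(H)`
(for a measure-preserving action of `Γ` on the probability space `(X,μ)`), then it is
the coboundary of the constant `T̂ = ∫ T dμ ∈ B(H)`. -/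
theorem statement5 (Γ : Type*) [Group Γ] [Countable Γ]
    (X : Type*) [MeasurableSpace X] (μ : Measure X) [IsProbabilityMeasure μ]
    [MulAction Γ X] (hmp : ∀ γ : Γ, MeasurePreserving (fun x : X => γ • x) μ μ)
    (H : Type*) [NormedAddCommGroup H] [InnerProductSpace ℂ H] [CompleteSpace H]
    (σ : Γ →* unitary (H →L[ℂ] H))
    (f : Γ → Γ → (H →L[ℂ] H)) (hfb : ∃ C : ℝ, ∀ γ₀ γ₁ : Γ, ‖f γ₀ γ₁‖ ≤ C)
    (T : X → (H →L[ℂ] H)) (hTi : Integrable T μ)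
    (hTb : ∃ C : ℝ, ∀ᵐ x ∂μ, ‖T x‖ ≤ C)
    (hcob : ∀ γ₀ γ₁ : Γ, ∀ᵐ x ∂μ,
      f γ₀ γ₁ = conjAct σ γ₀ (T (γ₀⁻¹ • x)) - conjAct σ γ₁ (T (γ₁⁻¹ • x))) :
    ∀ γ₀ γ₁ : Γ, f γ₀ γ₁ = conjAct σ γ₀ (∫ x, T x ∂μ) - conjAct σ γ₁ (∫ x, T x ∂μ) := by
  intro γ₀ γ₁
  obtain ⟨hi₀, he₀⟩ := integrable_and_integral_conjAct_comp σ γ₀ (hmp γ₀⁻¹) hTi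
  obtain ⟨hi₁, he₁⟩ := integrable_and_integral_conjAct_comp σ γ₁ (hmp γ₁⁻¹) hTi
  rw [← he₀, ← he₁, ← integral_sub hi₀ hi₁, ← integral_congr_ae (hcob γ₀ γ₁)]
  simp
end

section
/- Let Γ and G be countable infinite groups such that Γ orbitally embeds in G, witnessed by essentially free measure-preserving actions of Γ and G on a standard Borel probability space (X,μ) with Γx ⊆ Gx for μ-a.e. x. Then Γ randomly embeds in G. More precisely: for μ-a.e. x there is a unique map h_x: Γ → G determined by γx = h_x(γ)x for all γ ∈ Γ; for a.e. x the map h_x is injective with h_x(1) = 1 (so h_x ∈ [Γ,G]); and the pushforward of μ under x ↦ h_x is a Γ-invariant probability measure on [Γ,G]. -/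
open MeasureTheory

/-- `[Γ,G]`: the set of injective maps `h : Γ → G` with `h 1 = 1`, as a subset of the
product space `G^Γ`. -/
def embSet (Γ G : Type*) [Group Γ] [Group G] : Set (Γ → G) :=
  {h | Function.Injective h ∧ h 1 = 1}

/-- The action of `Γ` on maps `h : Γ → G`: `(γ·h)(t) = h(tγ) h(γ)⁻¹`. -/
def gammaAct {Γ G : Type*} [Group Γ] [Group G] (γ : Γ) (h : Γ → G) : Γ → G :=
  fun t => h (t * γ) * (h γ)⁻¹

theorem measurable_gammaAct {Γ G : Type*} [Group Γ] [Group G] [Countable G]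
    [MeasurableSpace G] [DiscreteMeasurableSpace G] (γ : Γ) :
    Measurable (gammaAct γ : (Γ → G) → Γ → G) := by
  refine measurable_pi_iff.2 fun t => ?_
  have hpair : Measurable fun h : Γ → G => (h (t * γ), h γ) :=
    (measurable_pi_apply _).prodMk (measurable_pi_apply _)
  exact (Measurable.of_discrete (f := fun p : G × G => p.1 * p.2⁻¹)).comp hpair

theorem measurableSet_embSet (Γ G : Type*) [Group Γ] [Group G] [Countable Γ] [Countable G]
    [MeasurableSpace G] [DiscreteMeasurableSpace G] :
    MeasurableSet (embSet Γ G) := by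
  have h1 : MeasurableSet {h : Γ → G | h 1 = 1} :=
    measurableSet_eq_fun (measurable_pi_apply 1) measurable_const
  have h2 : MeasurableSet {h : Γ → G | Function.Injective h} := by
    have : {h : Γ → G | Function.Injective h} =
        ⋂ a : Γ, ⋂ b : Γ, {h : Γ → G | h a = h b → a = b} := by
      ext h
      simp [Function.Injective]
    rw [this]
    refine MeasurableSet.iInter fun a => MeasurableSet.iInter fun b => ?_
    have hpair : Measurable fun h : Γ → G => (h a, h b) :=
      (measurable_pi_apply _).prodMk (measurable_pi_apply _)
    exact hpair (MeasurableSet.of_discrete (s := {p : G × G | p.1 = p.2 → a = b}))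
  exact h2.inter h1

/-- An orbital embedding yields a random embedding: if `Γ` and `G` have essentially
free measure-preserving actions on a standard probability space `(X,μ)` with
`Γx ⊆ Gx` a.e., then the a.e.-defined maps `h_x : Γ → G` with `γ x = h_x(γ) x`
are a.e. unique, a.e. injective with `h_x(1) = 1`, and the pushforward of `μ` under
`x ↦ h_x` is a `Γ`-invariant probability measure on `[Γ,G]`. -/
theorem statement9 (Γ G : Type*) [Group Γ] [Group G]
    [Countable Γ] [Countable G] [Infinite Γ] [Infinite G]
    [MeasurableSpace G] [DiscreteMeasurableSpace G]
    (X : Type*) [MeasurableSpace X] [StandardBorelSpace X]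
    (μ : Measure X) [IsProbabilityMeasure μ]
    [MulAction Γ X] [MulAction G X]
    (hmpΓ : ∀ γ : Γ, MeasurePreserving (fun x : X => γ • x) μ μ)
    (hmpG : ∀ g : G, MeasurePreserving (fun x : X => g • x) μ μ)
    (hfreeΓ : ∀ᵐ x ∂μ, Function.Injective fun γ : Γ => γ • x)
    (hfreeG : ∀ᵐ x ∂μ, Function.Injective fun g : G => g • x)
    (horb : ∀ᵐ x ∂μ, ∀ γ : Γ, ∃ g : G, γ • x = g • x) :
    ∃ h : X → Γ → G, Measurable h ∧
      (∀ᵐ x ∂μ, ∀ γ : Γ, γ • x = h x γ • x) ∧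
      (∀ᵐ x ∂μ, ∀ (γ : Γ) (g : G), γ • x = g • x → g = h x γ) ∧
      (∀ᵐ x ∂μ, h x ∈ embSet Γ G) ∧
      IsProbabilityMeasure (Measure.map h μ) ∧
      Measure.map h μ (embSet Γ G)ᶜ = 0 ∧
      ∀ γ : Γ, Measure.map (gammaAct γ) (Measure.map h μ) = Measure.map h μ := by
  classical
  obtain ⟨S, hS, hSm, hSgood⟩ : ∃ S ∈ ae μ, MeasurableSet S ∧ ∀ x ∈ S,
      (Function.Injective fun γ : Γ => γ • x) ∧ (Function.Injective fun g : G => g • x) ∧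
        ∀ γ : Γ, ∃ g : G, γ • x = g • x :=
    (hfreeΓ.and (hfreeG.and horb)).exists_measurable_mem
  replace hS : ∀ᵐ x ∂μ, x ∈ S := hS
  let h : X → Γ → G := fun x γ =>
    if hx : x ∈ S then ((hSgood x hx).2.2 γ).choose else 1
  have hspec : ∀ x ∈ S, ∀ γ : Γ, γ • x = h x γ • x := fun x hx γ => by
    simp only [h, dif_pos hx]
    exact ((hSgood x hx).2.2 γ).choose_spec
  have huniq : ∀ x ∈ S, ∀ (γ : Γ) (g : G), γ • x = g • x → g = h x γ := fun x hx γ g hg =>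
    (hSgood x hx).2.1 (hg.symm.trans (hspec x hx γ))
  have hemb : ∀ x ∈ S, h x ∈ embSet Γ G := fun x hx => by
    refine ⟨fun a b hab => (hSgood x hx).1 ?_, (huniq x hx 1 1 (by simp)).symm⟩
    change a • x = b • x
    rw [hspec x hx a, hspec x hx b, hab]
  have hmeas : Measurable h := by
    refine measurable_pi_iff.2 fun γ => measurable_to_countable' fun g => ?_
    have hEq : MeasurableSet {x : X | γ • x = g • x} :=
      measurableSet_eq_fun (hmpΓ γ).measurable (hmpG g).measurable
    have : (fun x => h x γ) ⁻¹' {g} =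
        S ∩ {x : X | γ • x = g • x} ∪ Sᶜ ∩ {_x : X | (1 : G) = g} := by
      ext x
      by_cases hx : x ∈ S
      · simp only [Set.mem_preimage, Set.mem_singleton_iff, Set.mem_union, Set.mem_inter_iff, hx,
          Set.mem_ofPred_eq, true_and, Set.mem_compl_iff, not_true_eq_false, false_and, or_false]
        exact ⟨fun e => e ▸ hspec x hx γ, fun e => (huniq x hx γ g e).symm⟩
      · simp [h, hx]
    rw [this]
    exact (hSm.inter hEq).union (hSm.compl.inter (MeasurableSet.const _))
  have hembae : ∀ᵐ x ∂μ, h x ∈ embSet Γ G := hS.mono hemb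
  refine ⟨h, hmeas, hS.mono hspec, hS.mono huniq, hembae,
    Measure.isProbabilityMeasure_map hmeas.aemeasurable, ?_, fun γ => ?_⟩
  · exact (ae_map_iff hmeas.aemeasurable (measurableSet_embSet Γ G)).2 hembae
  · have hcocycle : gammaAct γ ∘ h =ᵐ[μ] h ∘ fun x => γ • x := by
      filter_upwards [hS, (hmpΓ γ).quasiMeasurePreserving.ae hS] with x hx hγx
      funext t
      have key : h x (t * γ) = h (γ • x) t * h x γ := by
        refine (huniq x hx (t * γ) _ ?_).symm
        rw [mul_smul, mul_smul, ← hspec x hx γ, ← hspec (γ • x) hγx t]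
      simp [gammaAct, key]
    rw [Measure.map_map (measurable_gammaAct γ) hmeas, Measure.map_congr hcocycle,
      ← Measure.map_map hmeas (hmpΓ γ).measurable, (hmpΓ γ).map_eq]
end

section
/- Let Γ and G be countable discrete groups and let P be a Γ-invariant probability measure on [Γ,G]. Then for every g ∈ G one has ∑_{γ∈Γ} P({h ∈ [Γ,G] : h(γ) = g}) ≤ 1. Consequently, for every f ∈ ℓ₁(G), the function f̂(γ) = ∫_{[Γ,G]} f(h(γ)) dP(h) belongs to ℓ₁(Γ) with ∑_{γ∈Γ} |f̂(γ)| ≤ ∑_{g∈G} |f(g)|. -/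
open MeasureTheory
open scoped ENNReal

/-- Almost surely `h` is injective, so the values `h γ` hit each point of `G` at most once. -/
theorem tsum_lintegral_comp_eval_le {Γ G : Type*} [Group Γ] [Group G] [Countable Γ]
    [MeasurableSpace G] [DiscreteMeasurableSpace G]
    (P : Measure (Γ → G)) [IsProbabilityMeasure P]
    (hsupp : P (embSet Γ G)ᶜ = 0) (φ : G → ℝ≥0∞) :
    ∑' γ : Γ, ∫⁻ h, φ (h γ) ∂P ≤ ∑' g : G, φ g := by
  have hmeas (γ : Γ) : Measurable fun h : Γ → G => φ (h γ) :=
    Measurable.of_discrete.comp (measurable_pi_apply γ)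
  have hae : ∀ᵐ h ∂P, h ∈ embSet Γ G := hsupp
  calc ∑' γ : Γ, ∫⁻ h, φ (h γ) ∂P = ∫⁻ h, ∑' γ : Γ, φ (h γ) ∂P :=
        (lintegral_tsum fun γ => (hmeas γ).aemeasurable).symm
    _ ≤ ∫⁻ _, ∑' g : G, φ g ∂P := by
        refine lintegral_mono_ae ?_
        filter_upwards [hae] with h hh
        exact ENNReal.tsum_comp_le_tsum_of_injective hh.1 φ
    _ = ∑' g : G, φ g := by simp

/-- If `P` is a `Γ`-invariant probability measure on `[Γ,G]`, then
`∑_γ P({h : h(γ) = g}) ≤ 1` for every `g ∈ G`; consequently for `f ∈ ℓ₁(G)` the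
function `f̂(γ) = ∫ f(h(γ)) dP(h)` lies in `ℓ₁(Γ)` with `‖f̂‖₁ ≤ ‖f‖₁`. -/
theorem statement12 (Γ G : Type*) [Group Γ] [Group G] [Countable Γ] [Countable G]
    [MeasurableSpace G] [DiscreteMeasurableSpace G]
    (P : Measure (Γ → G)) [IsProbabilityMeasure P]
    (hsupp : P (embSet Γ G)ᶜ = 0)
    (hinv : ∀ γ : Γ, Measure.map (gammaAct γ) P = P) :
    (∀ g : G, ∑' γ : Γ, P {h : Γ → G | h γ = g} ≤ 1) ∧
    ∀ f : G → ℂ, Summable (fun g : G => ‖f g‖) →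
      Summable (fun γ : Γ => ‖∫ h, f (h γ) ∂P‖) ∧
      ∑' γ : Γ, ‖∫ h, f (h γ) ∂P‖ ≤ ∑' g : G, ‖f g‖ := by
  refine ⟨fun g => ?_, fun f hf => ?_⟩
  · have hle := tsum_lintegral_comp_eval_le P hsupp (Set.indicator {g} 1)
    have hev (γ : Γ) : ∫⁻ h, Set.indicator {g} (1 : G → ℝ≥0∞) (h γ) ∂P = P {h | h γ = g} :=
      lintegral_indicator_one (measurable_pi_apply γ (MeasurableSet.of_discrete (s := {g})))
    have hsum : ∑' x : G, Set.indicator {g} (1 : G → ℝ≥0∞) x = 1 := by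
      rw [← tsum_subtype]
      simp
    simpa only [hev, hsum] using hle
  · have hle : ∑' γ : Γ, ‖∫ h, f (h γ) ∂P‖ₑ ≤ ∑' g : G, ‖f g‖ₑ :=
      (ENNReal.tsum_le_tsum fun γ => enorm_integral_le_lintegral_enorm _).trans
        (tsum_lintegral_comp_eval_le P hsupp fun g => ‖f g‖ₑ)
    have hG : ∑' g : G, ‖f g‖ₑ = ENNReal.ofReal (∑' g : G, ‖f g‖) := by
      simp_rw [← ofReal_norm]
      exact (ENNReal.ofReal_tsum_of_nonneg (fun _ => norm_nonneg _) hf).symm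
    have hΓ : Summable (fun γ : Γ => ‖∫ h, f (h γ) ∂P‖) := by
      have hne : ∑' γ : Γ, ‖∫ h, f (h γ) ∂P‖ₑ ≠ ∞ :=
        ne_top_of_le_ne_top (hG ▸ ENNReal.ofReal_ne_top) hle
      simpa using ENNReal.summable_toReal hne
    refine ⟨hΓ, ?_⟩
    rw [← ENNReal.ofReal_le_ofReal_iff (tsum_nonneg fun _ => norm_nonneg _), ← hG,
      ENNReal.ofReal_tsum_of_nonneg (fun _ => norm_nonneg _) hΓ]
    simpa only [ofReal_norm] using hle
end

section
/- Let Γ and G be countable discrete groups and let P be a Γ-invariant probability measure on [Γ,G]. Let Ω = G^Γ with the product σ-algebra, let Γ act on Ω by (ρ(γ)ω)(t) = ω(tγ), and let G act on Ω by (g·ω)(t) = ω(t)g⁻¹. Define the σ-finite measure μ on Ω by μ(E) = ∑_{g∈G} P({h ∈ [Γ,G] : g·h ∈ E}). Then μ is invariant under ρ(γ) for every γ ∈ Γ, i.e. the pushforward of μ under ρ(γ) equals μ. -/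
open MeasureTheory

/-- Right translation of the values of a map by a fixed group element is measurable. -/
theorem measurable_pi_mul_inv_const {Γ G : Type*} [Group G] [MeasurableSpace G]
    [DiscreteMeasurableSpace G] (g : G) :
    Measurable (fun h : Γ → G => fun t : Γ => h t * g⁻¹) :=
  measurable_pi_lambda _ fun t =>
    (Measurable.of_discrete (f := fun x : G => x * g⁻¹)).comp (measurable_pi_apply t)

/-- Shifting by `γ` and then summing over the `G`-orbit is the same as summing over the `G`-orbit
of `γ·h`, since `h(tγ) g⁻¹ = (γ·h)(t) (g h(γ)⁻¹)⁻¹`. -/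
theorem tsum_shift_eq_tsum_gammaAct {Γ G : Type*} [Group Γ] [Group G]
    (γ : Γ) (h : Γ → G) (f : (Γ → G) → ENNReal) :
    ∑' g : G, f (fun t => h (t * γ) * g⁻¹) = ∑' g : G, f (fun t => gammaAct γ h t * g⁻¹) := by
  rw [← (Equiv.mulRight (h γ)⁻¹).tsum_eq fun g : G => f (fun t => gammaAct γ h t * g⁻¹)]
  simp [gammaAct, mul_assoc]

/-- Let `P` be a `Γ`-invariant probability measure on `[Γ,G]`, let `Γ` act on
`Ω = G^Γ` by `(ρ(γ)ω)(t) = ω(tγ)`, `G` by `(g·ω)(t) = ω(t)g⁻¹`, and let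
`μ(E) = ∑_g P({h : g·h ∈ E})`.  Then `μ` is `ρ(Γ)`-invariant. -/
theorem statement14 (Γ G : Type*) [Group Γ] [Group G] [Countable Γ] [Countable G]
    [MeasurableSpace G] [DiscreteMeasurableSpace G]
    (P : Measure (Γ → G)) [IsProbabilityMeasure P]
    (hsupp : P (embSet Γ G)ᶜ = 0)
    (hinv : ∀ γ : Γ, Measure.map (gammaAct γ) P = P)
    (μ : Measure (Γ → G))
    (hμ : μ = Measure.sum fun g : G =>
      Measure.map (fun h : Γ → G => fun t : Γ => h t * g⁻¹) P) :
    ∀ γ : Γ, Measure.map (fun ω : Γ → G => fun t : Γ => ω (t * γ)) μ = μ := by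
  intro γ
  subst hμ
  have hshift : Measurable (fun ω : Γ → G => fun t : Γ => ω (t * γ)) :=
    measurable_pi_lambda _ fun t => measurable_pi_apply (t * γ)
  have htrans := measurable_pi_mul_inv_const (Γ := Γ) (G := G)
  refine Measure.ext_of_lintegral _ fun f hf => ?_
  have hfshift : Measurable fun ω : Γ → G => f (fun t => ω (t * γ)) := hf.comp hshift
  have hterm : ∀ g : G, Measurable fun h : Γ → G => f (fun t => h t * g⁻¹) :=
    fun g => hf.comp (htrans g)
  have hshiftterm : ∀ g : G, Measurable fun h : Γ → G => f (fun t => h (t * γ) * g⁻¹) :=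
    fun g => hfshift.comp (htrans g)
  rw [lintegral_map hf hshift, lintegral_sum_measure, lintegral_sum_measure,
    tsum_congr fun g : G => lintegral_map (μ := P) hfshift (htrans g),
    tsum_congr fun g : G => lintegral_map (μ := P) hf (htrans g),
    ← lintegral_tsum fun g => (hshiftterm g).aemeasurable,
    ← lintegral_tsum fun g => (hterm g).aemeasurable]
  calc ∫⁻ h, ∑' g : G, f (fun t => h (t * γ) * g⁻¹) ∂P
      = ∫⁻ h, ∑' g : G, f (fun t => gammaAct γ h t * g⁻¹) ∂P :=
        lintegral_congr fun h => tsum_shift_eq_tsum_gammaAct γ h f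
    _ = ∫⁻ h, ∑' g : G, f (fun t => h t * g⁻¹) ∂(Measure.map (gammaAct γ) P) :=
        (lintegral_map (Measurable.tsum hterm) (measurable_gammaAct γ)).symm
    _ = ∫⁻ h, ∑' g : G, f (fun t => h t * g⁻¹) ∂P := by rw [hinv γ]
end

section
/- Let Γ and G be countable discrete groups and let P be a Γ-invariant probability measure on [Γ,G]. Let Ω = G^Γ with the product σ-algebra, let Γ act on Ω by (ρ(γ)ω)(t) = ω(tγ), let G act on Ω by (g·ω)(t) = ω(t)g⁻¹, and let μ be the σ-finite measure on Ω given by μ(E) = ∑_{g∈G} P({h ∈ [Γ,G] : g·h ∈ E}). Then the Γ-action ρ on (Ω,μ) admits a measurable fundamental domain: there exists a measurable set Y ⊆ Ω such that the sets {ρ(γ)⁻¹(Y) : γ ∈ Γ} are pairwise disjoint up to μ-null sets and their union covers Ω up to a μ-null set. -/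
open MeasureTheory

/-- The maps whose value at `1` comes first, among all their values, in an enumeration `e` of the
codomain. -/
def minAtOne (Γ : Type*) {G : Type*} [Group Γ] (e : G → ℕ) : Set (Γ → G) :=
  {ω | ∀ t, e (ω 1) ≤ e (ω t)}

theorem measurableSet_minAtOne (Γ : Type*) {G : Type*} [Group Γ] [Countable Γ]
    [MeasurableSpace G] [DiscreteMeasurableSpace G] (e : G → ℕ) :
    MeasurableSet (minAtOne Γ e) := by
  have he : Measurable e := Measurable.of_discrete
  simp only [minAtOne, Set.ofPred_forall]
  exact MeasurableSet.iInter fun t =>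
    measurableSet_le (he.comp (measurable_pi_apply 1)) (he.comp (measurable_pi_apply t))

theorem translate_mem_minAtOne_iff {Γ G : Type*} [Group Γ] {e : G → ℕ} {ω : Γ → G} {γ : Γ} :
    (fun t => ω (t * γ)) ∈ minAtOne Γ e ↔ ∀ t, e (ω γ) ≤ e (ω t) := by
  simp only [minAtOne, Set.mem_ofPred_eq, one_mul]
  exact ⟨fun h t => by simpa using h (t * γ⁻¹), fun h t => h _⟩

theorem exists_translate_mem_minAtOne {Γ G : Type*} [Group Γ] (e : G → ℕ) (ω : Γ → G) :
    ∃ γ : Γ, (fun t => ω (t * γ)) ∈ minAtOne Γ e := by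
  simp only [translate_mem_minAtOne_iff]
  exact ⟨Function.argmin (e ∘ ω), fun t => Function.argmin_le (e ∘ ω) t⟩

theorem eq_of_translate_mem_minAtOne {Γ G : Type*} [Group Γ] {e : G → ℕ}
    (he : Function.Injective e) {ω : Γ → G} (hω : Function.Injective ω) {γ γ' : Γ}
    (h : (fun t => ω (t * γ)) ∈ minAtOne Γ e) (h' : (fun t => ω (t * γ')) ∈ minAtOne Γ e) :
    γ = γ' := by
  rw [translate_mem_minAtOne_iff] at h h'
  exact hω (he (le_antisymm (h γ') (h' γ)))

/-- Let `P` be a `Γ`-invariant probability measure on `[Γ,G]`, let `Γ` act on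
`Ω = G^Γ` by `(ρ(γ)ω)(t) = ω(tγ)`, `G` by `(g·ω)(t) = ω(t)g⁻¹`, and let
`μ(E) = ∑_g P({h : g·h ∈ E})`.  Then the `Γ`-action `ρ` on `(Ω,μ)` admits a
measurable fundamental domain `Y`: the sets `ρ(γ)⁻¹(Y)` are pairwise disjoint up
to `μ`-null sets and cover `Ω` up to a `μ`-null set. -/
theorem statement15 (Γ G : Type*) [Group Γ] [Group G] [Countable Γ] [Countable G]
    [MeasurableSpace G] [DiscreteMeasurableSpace G]
    (P : Measure (Γ → G)) [IsProbabilityMeasure P]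
    (hsupp : P (embSet Γ G)ᶜ = 0)
    (hinv : ∀ γ : Γ, Measure.map (gammaAct γ) P = P)
    (μ : Measure (Γ → G))
    (hμ : μ = Measure.sum fun g : G =>
      Measure.map (fun h : Γ → G => fun t : Γ => h t * g⁻¹) P) :
    ∃ Y : Set (Γ → G), MeasurableSet Y ∧
      (∀ γ γ' : Γ, γ ≠ γ' →
        μ ((fun ω : Γ → G => fun t : Γ => ω (t * γ)) ⁻¹' Y ∩
           (fun ω : Γ → G => fun t : Γ => ω (t * γ')) ⁻¹' Y) = 0) ∧
      μ (⋃ γ : Γ, (fun ω : Γ → G => fun t : Γ => ω (t * γ)) ⁻¹' Y)ᶜ = 0 := by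
  obtain ⟨e, he⟩ := exists_injective_nat G
  have hY := measurableSet_minAtOne Γ e
  have hshift (γ : Γ) : Measurable fun ω : Γ → G => fun t : Γ => ω (t * γ) :=
    measurable_pi_lambda _ fun t => measurable_pi_apply (t * γ)
  refine ⟨minAtOne Γ e, hY, fun γ γ' hne => ?_, ?_⟩
  · have hE := (hshift γ hY).inter (hshift γ' hY)
    rw [hμ, Measure.sum_apply _ hE, ENNReal.tsum_eq_zero]
    intro g
    have hg : Measurable fun h : Γ → G => fun t : Γ => h t * g⁻¹ :=
      measurable_pi_lambda _ fun t =>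
        (Measurable.of_discrete (f := fun x : G => x * g⁻¹)).comp (measurable_pi_apply t)
    rw [Measure.map_apply hg hE]
    refine measure_mono_null (t := (embSet Γ G)ᶜ) (fun h hh (hemb : h ∈ embSet Γ G) => hne ?_) hsupp
    exact eq_of_translate_mem_minAtOne he ((mul_left_injective g⁻¹).comp hemb.1) hh.1 hh.2
  · rw [Set.compl_empty_iff.mpr, measure_empty]
    exact Set.iUnion_eq_univ_iff.mpr (exists_translate_mem_minAtOne e)
end

section
/- Let G be a countable group such that the free group F₂ on two generators orbitally embeds in G. Then for every infinite abelian group A, the wreath product A≀G is not unitarizable. -/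
/-- `A^{(G)}`: the direct sum of copies of `A` indexed by `G`, realized as the subgroup
of `G → A` consisting of finitely supported functions (pointwise product). -/
def finSupp (G A : Type*) [Group A] : Subgroup (G → A) where
  carrier := {a | {t | a t ≠ 1}.Finite}
  one_mem' := by simp
  mul_mem' := by
    intro a b ha hb
    refine (ha.union hb).subset fun t ht => ?_
    by_contra hc
    simp only [Set.mem_union, Set.mem_setOf_eq, not_or, not_not] at hc
    exact ht (show a t * b t = 1 by rw [hc.1, hc.2, one_mul])
  inv_mem' := by
    intro a ha
    refine ha.subset fun t ht => ?_
    simp only [Set.mem_setOf_eq] at ht ⊢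
    exact fun h => ht (show a⁻¹ t = 1 by simp only [Pi.inv_apply, h, inv_one])

/-- The shift by `g ∈ G` on `A^{(G)}`: `(g·a)(t) = a(g⁻¹t)`, as a group automorphism. -/
def shiftEquiv (A G : Type*) [Group A] [Group G] (g : G) :
    ↥(finSupp G A) ≃* ↥(finSupp G A) where
  toFun a := ⟨fun t => (a : G → A) (g⁻¹ * t), by
    refine ((a.2.image (fun t => g * t)).subset ?_)
    intro t ht
    exact ⟨g⁻¹ * t, ht, by group⟩⟩
  invFun a := ⟨fun t => (a : G → A) (g * t), by
    refine ((a.2.image (fun t => g⁻¹ * t)).subset ?_)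
    intro t ht
    exact ⟨g * t, ht, by group⟩⟩
  left_inv a := Subtype.ext (funext fun t => by simp)
  right_inv a := Subtype.ext (funext fun t => by simp)
  map_mul' a b := rfl

/-- The shift action of `G` on `A^{(G)}` as a homomorphism `G →* Aut(A^{(G)})`. -/
def shiftHom (A G : Type*) [Group A] [Group G] : G →* MulAut ↥(finSupp G A) where
  toFun g := shiftEquiv A G g
  map_one' := by
    ext a t
    simp [shiftEquiv]
  map_mul' g₁ g₂ := by
    ext a t
    simp [shiftEquiv, mul_assoc]

/-- The wreath product `A ≀ G = A^{(G)} ⋊ G`. -/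
abbrev Wreath (A G : Type*) [Group A] [Group G] :=
  (finSupp G A) ⋊[shiftHom A G] G

/-- An orbital embedding of `Γ` into `G`: essentially free measure-preserving actions
of `Γ` and `G` on a standard Borel probability space `(X,μ)` such that `Γx ⊆ Gx`
for a.e. `x`. -/
structure OrbitalEmbedding (Γ G : Type*) [Group Γ] [Group G] where
  X : Type
  [mX : MeasurableSpace X]
  [sb : StandardBorelSpace X]
  μ : MeasureTheory.Measure X
  [prob : MeasureTheory.IsProbabilityMeasure μ]
  aΓ : Γ → X → X
  aG : G → X → X
  aΓ_one : ∀ x, aΓ 1 x = x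
  aΓ_mul : ∀ γ γ' x, aΓ (γ * γ') x = aΓ γ (aΓ γ' x)
  aG_one : ∀ x, aG 1 x = x
  aG_mul : ∀ g g' x, aG (g * g') x = aG g (aG g' x)
  mpΓ : ∀ γ, MeasureTheory.MeasurePreserving (aΓ γ) μ μ
  mpG : ∀ g, MeasureTheory.MeasurePreserving (aG g) μ μ
  freeΓ : ∀ᵐ x ∂μ, Function.Injective fun γ => aΓ γ x
  freeG : ∀ᵐ x ∂μ, Function.Injective fun g => aG g x
  orbit : ∀ᵐ x ∂μ, ∀ γ, ∃ g, aΓ γ x = aG g x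

open MeasureTheory

noncomputable instance circleMeasurableSpace : MeasurableSpace Circle := borel Circle

instance circleBorelSpace : BorelSpace Circle := ⟨rfl⟩

theorem exists_monoidHom_circle_ne_one {A : Type} [CommGroup A] {a : A} (ha : a ≠ 1) :
    ∃ χ : A →* Circle, χ a ≠ 1 := by
  obtain ⟨c, hc⟩ := CharacterModule.exists_character_apply_ne_zero_of_ne_zero
    (A := Additive A) (a := Additive.ofMul a) (by simpa using ha)
  let j : AddCircle (1 : ℚ) →+ AddCircle (1 : ℝ) :=
    QuotientAddGroup.map _ _ (algebraMap ℚ ℝ).toAddMonoidHom (by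
      rw [AddSubgroup.zmultiples_le]
      simp [AddSubgroup.mem_zmultiples])
  have hj : ∀ y, j y = 0 → y = 0 := by
    intro y
    induction y using QuotientAddGroup.induction_on with
    | H r =>
      intro h
      have h' : ((algebraMap ℚ ℝ r : ℝ) : AddCircle (1 : ℝ)) = 0 := h
      rw [AddCircle.coe_eq_zero_iff] at h'
      obtain ⟨n, hn⟩ := h'
      refine (AddCircle.coe_eq_zero_iff (1 : ℚ)).2 ⟨n, ?_⟩
      have : ((n • (1 : ℚ) : ℚ) : ℝ) = (r : ℝ) := by simpa using hn
      exact_mod_cast this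
  refine ⟨⟨⟨fun b => AddCircle.toCircle (j (c (Additive.ofMul b))), by simp⟩, fun x y => by
    simp [AddCircle.toCircle_add]⟩, fun h => hc (hj _ ?_)⟩
  apply AddCircle.injective_toCircle one_ne_zero
  simpa using h

theorem finite_nthRoots_circle {n : ℕ} (hn : 0 < n) : {z : Circle | z ^ n = 1}.Finite := by
  have h : {z : ℂ | z ^ n = 1}.Finite := by
    refine (Polynomial.nthRoots n (1 : ℂ)).toFinset.finite_toSet.subset fun z hz => ?_
    simpa [Polynomial.mem_nthRoots hn] using hz
  refine (h.preimage (f := fun z : Circle => (z : ℂ)) Circle.coe_injective.injOn).subset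
    fun z hz => ?_
  have : z ^ n = 1 := hz
  show ((z : ℂ)) ^ n = 1
  rw [← Circle.coe_pow, this, Circle.coe_one]

theorem not_countable_characters (A : Type) [CommGroup A] [Infinite A] :
    ¬ Countable (A →* Circle) := by
  intro hc
  let : TopologicalSpace A := ⊥
  have : DiscreteTopology A := ⟨rfl⟩
  have hinj : Function.Injective (fun χ : PontryaginDual A => (χ : A →ₜ* Circle).toMonoidHom) := by
    intro χ ψ h
    apply PontryaginDual.ext
    intro a
    exact DFunLike.congr_fun h a
  have : Countable (PontryaginDual A) := hinj.countable
  obtain ⟨χ, hχ⟩ := nonempty_interior_of_iUnion_of_closed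
    (f := fun χ : PontryaginDual A => ({χ} : Set (PontryaginDual A)))
    (fun χ => isClosed_singleton) (Set.iUnion_of_singleton _)
  have hχo : IsOpen ({χ} : Set (PontryaginDual A)) := by
    have : interior ({χ} : Set (PontryaginDual A)) = {χ} := by
      rcases (Set.subset_singleton_iff_eq.1 (interior_subset (s := {χ}))) with h | h
      · rw [h] at hχ; exact absurd hχ (by simp)
      · exact h
    rw [← this]; exact isOpen_interior
  have h1 : IsOpen ({1} : Set (PontryaginDual A)) := by
    have := (Homeomorph.mulLeft χ⁻¹).isOpenMap _ hχo
    simpa using this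
  have := discreteTopology_of_isOpen_singleton_one h1
  have : Finite (PontryaginDual A) := finite_of_compact_of_discrete
  set n := Nat.card (PontryaginDual A)
  have hn : 0 < n := Nat.card_pos
  have : Finite {z : Circle | z ^ n = 1} := finite_nthRoots_circle hn
  let ev : A → PontryaginDual A → {z : Circle | z ^ n = 1} := fun a χ => ⟨χ a, by
    show (χ a) ^ n = 1
    have h := map_pow (MonoidHom.mk' (fun ψ : PontryaginDual A => ψ a) fun _ _ => rfl) χ n
    rw [pow_card_eq_one', map_one] at h
    exact h.symm⟩
  have hev : Function.Injective ev := by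
    intro a b hab
    by_contra hne
    obtain ⟨χ, hχ⟩ := exists_monoidHom_circle_ne_one (a := a * b⁻¹) (by
      rwa [Ne, mul_inv_eq_one])
    have := congrArg Subtype.val (congrFun hab (⟨χ, continuous_of_discreteTopology⟩ : A →ₜ* Circle))
    apply hχ
    rw [map_mul, map_inv, mul_inv_eq_one]
    exact this
  exact not_finite_iff_infinite.2 ‹Infinite A› (Finite.of_injective ev hev)

/-- The group of measurable circle-valued functions. -/
def measurableCircle (X : Type) [MeasurableSpace X] : Subgroup (X → Circle) where
  carrier := {f | Measurable f}
  one_mem' := measurable_one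
  mul_mem' := fun hf hg => Measurable.mul hf hg
  inv_mem' := fun hf => Measurable.inv hf

theorem measurable_circle_arg : Measurable fun z : Circle => Complex.arg z :=
  Complex.measurable_arg.comp (by fun_prop : Continuous fun z : Circle => (z : ℂ)).measurable

noncomputable instance measurableCircleDivisible (X : Type) [MeasurableSpace X] :
    DivisibleBy (Additive (measurableCircle X)) ℤ where
  div f n := Additive.ofMul ⟨fun x => Circle.exp (Complex.arg ((f.toMul : X → Circle) x) / n),
    Circle.exp.continuous.measurable.comp
      ((measurable_circle_arg.comp f.toMul.2).div_const _)⟩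
  div_zero f := by
    apply Additive.toMul.injective
    apply Subtype.ext
    funext x
    simp
  div_cancel {n} f hn := by
    apply Additive.toMul.injective
    apply Subtype.ext
    funext x
    have hn' : (n : ℝ) ≠ 0 := by exact_mod_cast hn
    simp only [toMul_zsmul, toMul_ofMul, SubgroupClass.coe_zpow, Pi.pow_apply]
    rw [← Circle.exp_zsmul, zsmul_eq_mul, mul_div_cancel₀ _ hn', Circle.exp_arg]

theorem exists_measurable_characters (A : Type) [CommGroup A] [Infinite A]
    (X : Type) [MeasurableSpace X] [StandardBorelSpace X] :
    ∃ φ : A →* (X → Circle), (∀ a, Measurable (φ a)) ∧ ∃ S : Set A, S.Countable ∧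
      MeasurableEmbedding (fun (x : X) (a : S) => φ a x) := by
  let B : Subgroup A := (FreeGroup.lift (Infinite.natEmbedding A)).range
  have : Countable B := (MonoidHom.rangeRestrict_surjective
    (FreeGroup.lift (Infinite.natEmbedding A))).countable
  have : Infinite B := Infinite.of_injective
    (fun n : ℕ => (⟨Infinite.natEmbedding A n, FreeGroup.of n, by simp⟩ : B))
    (fun m n h => (Infinite.natEmbedding A).injective (congrArg Subtype.val h))
  let C : Set (B → Circle) := {f | ∀ a b, f (a * b) = f a * f b}
  have hC : IsClosed C := by
    simp only [C, Set.ofPred_forall]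
    exact isClosed_iInter fun a => isClosed_iInter fun b =>
      isClosed_eq (continuous_apply _) (by fun_prop)
  have hCu : ¬ Countable C := by
    intro h
    refine not_countable_characters B ?_
    exact Function.Injective.countable
      (f := fun χ : B →* Circle => (⟨fun b => χ b, fun a b => map_mul χ a b⟩ : C))
      (fun χ ψ h => by ext b; exact congrArg _ (congrFun (congrArg Subtype.val h) b))
  have : StandardBorelSpace C := hC.measurableSet.standardBorel
  obtain ⟨r, hr⟩ := exists_measurableEmbedding_real X
  let e : ℝ ≃ᵐ C := PolishSpace.measurableEquivOfNotCountable
    (by simp) hCu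
  let ψ : X → (B → Circle) := fun x => (e (r x) : B → Circle)
  have hψ : MeasurableEmbedding ψ :=
    (MeasurableEmbedding.subtype_coe hC.measurableSet).comp (e.measurableEmbedding.comp hr)
  let φ₀ : B →* measurableCircle X :=
    { toFun := fun b => ⟨fun x => ψ x b, (measurable_pi_apply b).comp hψ.measurable⟩
      map_one' := by
        apply Subtype.ext
        funext x
        have h := (e (r x)).2 1 1
        simpa using h
      map_mul' := fun a b => by
        apply Subtype.ext
        funext x
        exact (e (r x)).2 a b }
  obtain ⟨φ, hφ⟩ := (Module.Baer.of_divisible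
    (Additive (measurableCircle X))).extension_property_addMonoidHom
    (MonoidHom.toAdditive B.subtype) (fun a b h => B.subtype_injective h)
    (MonoidHom.toAdditive φ₀)
  have hφ' : ∀ b : B, MonoidHom.toAdditive.symm φ (b : A) = φ₀ b := fun b =>
    congrArg Additive.toMul (DFunLike.congr_fun hφ (Additive.ofMul b))
  refine ⟨(measurableCircle X).subtype.comp (MonoidHom.toAdditive.symm φ), fun a =>
    (MonoidHom.toAdditive.symm φ a).2, B, Set.to_countable _, ?_⟩
  have heq : (fun (x : X) (b : (B : Set A)) =>
      ((measurableCircle X).subtype.comp (MonoidHom.toAdditive.symm φ)) b x) = ψ := by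
    funext x b
    exact congrFun (congrArg Subtype.val (hφ' b)) x
  rw [heq]
  exact hψ

/-- A bounded derivation of a unitarizable group along a contractive representation is inner. -/
theorem IsUnitarizableGroup.exists_derivation_eq {W : Type} [Group W] (hW : IsUnitarizableGroup W)
    {K : Type} [NormedAddCommGroup K] [InnerProductSpace ℂ K] [CompleteSpace K]
    (ρ : W →* (K →L[ℂ] K)) (δ : W → (K →L[ℂ] K))
    (hδ : ∀ s t, δ (s * t) = ρ s * δ t + δ s * ρ t)
    (hρ : ∀ s, ‖ρ s‖ ≤ 1) {C : ℝ} (hC : ∀ s, ‖δ s‖ ≤ C) :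
    ∃ q : K →L[ℂ] K, ∀ s, δ s = ρ s * q - q * ρ s := by
  have hδ1 : δ 1 = 0 := by
    have h := hδ 1 1
    simpa using h
  have hC0 : 0 ≤ C := (norm_nonneg _).trans (hC 1)
  let P₀ : W → (K × K →L[ℂ] K × K) := fun s =>
    (ρ s ∘L ContinuousLinearMap.fst ℂ K K + δ s ∘L ContinuousLinearMap.snd ℂ K K).prod
      (ρ s ∘L ContinuousLinearMap.snd ℂ K K)
  let e : WithLp 2 (K × K) ≃L[ℂ] K × K := WithLp.prodContinuousLinearEquiv 2 ℂ K K
  let P : W →* (WithLp 2 (K × K) →L[ℂ] WithLp 2 (K × K)) :=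
    { toFun := fun s => (e.symm : K × K →L[ℂ] WithLp 2 (K × K)) ∘L P₀ s ∘L
        (e : WithLp 2 (K × K) →L[ℂ] K × K)
      map_one' := by
        ext x : 1
        simp [P₀, hδ1]
      map_mul' := fun s t => by
        ext x : 1
        simp [P₀, hδ, add_assoc] }
  have hP₀ : ∀ s, ‖P₀ s‖ ≤ 1 + C := fun s => by
    refine ContinuousLinearMap.opNorm_le_bound _ (by positivity) fun x => ?_
    have h1 : ‖ρ s x.1‖ ≤ ‖x‖ := by
      have := (ρ s).le_of_opNorm_le (hρ s) x.1
      linarith [norm_fst_le x]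
    have h2 : ‖ρ s x.2‖ ≤ ‖x‖ := by
      have := (ρ s).le_of_opNorm_le (hρ s) x.2
      linarith [norm_snd_le x]
    have h3 : ‖δ s x.2‖ ≤ C * ‖x‖ :=
      ((δ s).le_of_opNorm_le (hC s) x.2).trans (by gcongr; exact norm_snd_le x)
    refine max_le ((norm_add_le _ _).trans ?_) ?_
    · show ‖ρ s x.1‖ + ‖δ s x.2‖ ≤ _
      linarith
    · show ‖ρ s x.2‖ ≤ _
      nlinarith [norm_nonneg x]
  have hP : ∀ s, ‖P s‖ ≤ ‖(e.symm : K × K →L[ℂ] WithLp 2 (K × K))‖ *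
      ((1 + C) * ‖(e : WithLp 2 (K × K) →L[ℂ] K × K)‖) := fun s =>
    (ContinuousLinearMap.opNorm_comp_le _ _).trans (by
      gcongr
      exact (ContinuousLinearMap.opNorm_comp_le _ _).trans (by gcongr; exact hP₀ s))
  obtain ⟨S, hS⟩ := hW (WithLp 2 (K × K)) P.toHomUnits ⟨_, fun s => hP s⟩
  let Sv : WithLp 2 (K × K) →L[ℂ] WithLp 2 (K × K) := S
  let Si : WithLp 2 (K × K) →L[ℂ] WithLp 2 (K × K) := (S⁻¹ : (_ →L[ℂ] _)ˣ)
  have hSSi : ∀ x, Sv (Si x) = x := fun x => DFunLike.congr_fun S.mul_inv x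
  have hSiS : ∀ x, Si (Sv x) = x := fun x => DFunLike.congr_fun S.inv_mul x
  have hPe : ∀ s x, e (P s x) = (ρ s (e x).1 + δ s (e x).2, ρ s (e x).2) := fun s x => by
    simp [P, P₀]
  let N : Submodule ℂ (WithLp 2 (K × K)) := LinearMap.ker
    ((ContinuousLinearMap.snd ℂ K K ∘L (e : WithLp 2 (K × K) →L[ℂ] K × K) ∘L Sv :
      WithLp 2 (K × K) →L[ℂ] K) : WithLp 2 (K × K) →ₗ[ℂ] K)
  have hN : IsClosed (N : Set (WithLp 2 (K × K))) := ContinuousLinearMap.isClosed_ker _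
  have : CompleteSpace N := hN.completeSpace_coe
  have hNm : ∀ x, x ∈ N ↔ (e (Sv x)).2 = 0 := fun x => Iff.rfl
  let u : W → (WithLp 2 (K × K) →L[ℂ] WithLp 2 (K × K)) := fun s => Si ∘L P s ∘L Sv
  have huN : ∀ s x, x ∈ N → u s x ∈ N := fun s x hx => by
    rw [hNm] at hx ⊢
    show (e (Sv (Si (P s (Sv x))))).2 = 0
    rw [hSSi, hPe, hx, map_zero]
    exact map_zero _
  have huu : ∀ s x, u s (u s⁻¹ x) = x := fun s x => by
    show Si (P s (Sv (Si (P s⁻¹ (Sv x))))) = x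
    rw [hSSi, ← mul_apply_eq_comp (P s), ← map_mul, mul_inv_cancel, map_one]
    exact hSiS x
  have huin : ∀ s x y, inner ℂ (u s x) (u s y) = inner ℂ x y := fun s x y => by
    have h : u s ∈ unitary (WithLp 2 (K × K) →L[ℂ] WithLp 2 (K × K)) := hS s
    exact ContinuousLinearMap.inner_map_map_of_mem_unitary h x y
  have hpu : ∀ s x, N.starProjection (u s x) = u s (N.starProjection x) := fun s x => by
    refine Submodule.eq_starProjection_of_mem_of_inner_eq_zero
      (huN s _ (N.starProjection_apply_mem x)) fun w hw => ?_
    rw [← map_sub, ← huu s w, huin]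
    exact Submodule.starProjection_inner_eq_zero x _ (huN _ _ hw)
  let Q : WithLp 2 (K × K) →L[ℂ] WithLp 2 (K × K) := Sv ∘L N.starProjection ∘L Si
  have hQP : ∀ s x, Q (P s x) = P s (Q x) := fun s x => by
    have h := congrArg Sv (hpu s (Si x))
    show Sv (N.starProjection (Si (P s x))) = P s (Sv (N.starProjection (Si x)))
    have h2 : u s (Si x) = Si (P s x) := by
      show Si (P s (Sv (Si x))) = _
      rw [hSSi]
    rw [← h2, h]
    exact hSSi _
  have hQ2 : ∀ x, (e (Q x)).2 = 0 := fun x => (hNm _).1 (N.starProjection_apply_mem (Si x))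
  have hQid : ∀ x, (e x).2 = 0 → Q x = x := fun x hx => by
    have hm : Si x ∈ N := by rw [hNm, hSSi]; exact hx
    show Sv (N.starProjection (Si x)) = x
    rw [Submodule.starProjection_eq_self_iff.2 hm, hSSi]
  let q : K →L[ℂ] K := ContinuousLinearMap.fst ℂ K K ∘L
    (e : WithLp 2 (K × K) →L[ℂ] K × K) ∘L Q ∘L
    (e.symm : K × K →L[ℂ] WithLp 2 (K × K)) ∘L ContinuousLinearMap.inr ℂ K K
  refine ⟨q, fun s => ?_⟩
  ext ξ
  have hl := congrArg (fun z => (e z).1) (hQP s (e.symm (0, ξ)))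
  have hr : (e (P s (Q (e.symm (0, ξ))))).1 = ρ s (q ξ) := by
    rw [hPe, hQ2]
    simp [q]
  have hdec : P s (e.symm (0, ξ)) = e.symm (δ s ξ, 0) + e.symm (0, ρ s ξ) := by
    apply e.injective
    rw [hPe]
    simp
  rw [hr, hdec, map_add, hQid (e.symm (δ s ξ, 0)) (by simp), map_add] at hl
  have hq : (e (Q (e.symm (0, ρ s ξ)))).1 = q (ρ s ξ) := rfl
  rw [Prod.fst_add, hq] at hl
  simp only [ContinuousLinearEquiv.apply_symm_apply] at hl
  show δ s ξ = ρ s (q ξ) - q (ρ s ξ)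
  rw [← hl]
  abel

namespace FreeGroup

theorem head?_toWord_or {ι : Type} [DecidableEq ι] (a : ι × Bool) (v : FreeGroup ι) :
    v.toWord.head? = some (a.1, !a.2) ∨ (FreeGroup.mk [a] * v).toWord.head? = some a := by
  have h : (FreeGroup.mk [a] * v).toWord = FreeGroup.reduce (a :: v.toWord) := by
    conv_lhs => rw [← FreeGroup.mk_toWord (x := v), FreeGroup.mul_mk]
    rw [FreeGroup.toWord_mk]
    rfl
  rw [h, FreeGroup.reduce.cons, FreeGroup.reduce_toWord]
  cases hv : v.toWord with
  | nil => simp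
  | cons b l =>
    by_cases hb : a.1 = b.1 ∧ a.2 = !b.2
    · left
      rw [hb.1, hb.2]
      simp
    · right
      simp [hb]

end FreeGroup

theorem exists_injective_nat_map_one (G : Type) [Group G] [Countable G] :
    ∃ e : G → ℕ, Function.Injective e ∧ e 1 = 0 := by
  classical
  obtain ⟨f, hf⟩ := exists_injective_nat G
  refine ⟨fun g => if g = 1 then 0 else f g + 1, fun g h hgh => ?_, by simp⟩
  by_cases hg : g = 1 <;> by_cases hh : h = 1 <;> simp_all [hf.eq_iff]

/-- The parent relation of the rooted forest on `G` defined, for each point `x`, by an action of a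
free group whose orbits are contained in those of `G`. -/
theorem exists_parent_relation {ι G X : Type} [DecidableEq ι] [Countable ι] [Group G] [Countable G]
    [MeasurableSpace X] [StandardBorelSpace X] [MulAction G X] [MulAction (FreeGroup ι) X]
    (hG : ∀ g : G, Measurable fun x : X => g • x)
    (hΓ : ∀ γ : FreeGroup ι, Measurable fun x : X => γ • x)
    (good : Set X) (hgood : MeasurableSet good) (hinv : ∀ x, ∀ g : G, g • x ∈ good ↔ x ∈ good)
    (hfΓ : ∀ x ∈ good, Function.Injective fun γ : FreeGroup ι => γ • x)
    (hfG : ∀ x ∈ good, Function.Injective fun g : G => g • x)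
    (horb : ∀ x ∈ good, ∀ γ : FreeGroup ι, ∃ g : G, γ • x = g • x) :
    ∃ Q : X → G → G → Prop, (∀ h k, MeasurableSet {x | Q x h k}) ∧
      (∀ x h k k', Q x h k → Q x h k' → k = k') ∧
      (∀ x g h₁ h₂ k, Q x h₁ k → Q x h₂ k → ¬ Q (g⁻¹ • x) (g⁻¹ * h₁) (g⁻¹ * k) →
        ¬ Q (g⁻¹ • x) (g⁻¹ * h₂) (g⁻¹ * k) → h₁ = h₂) ∧
      (∀ x k, ¬ Q x 1 k) ∧
      ∀ x ∈ good, ∀ i h, h⁻¹ • x = (FreeGroup.of i : FreeGroup ι) • x → Q x h 1 := by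
  have : Countable (FreeGroup ι) := inferInstance
  obtain ⟨e, he, he1⟩ := exists_injective_nat_map_one G
  let R : X → G → G → Prop := fun x h k =>
    (∃ γ : FreeGroup ι, h⁻¹ • x = γ • k⁻¹ • x) ∧
      ∀ k', (∃ γ : FreeGroup ι, h⁻¹ • x = γ • k'⁻¹ • x) → e k ≤ e k'
  let D : X → G → FreeGroup ι → Prop := fun x h γ => ∃ k, R x h k ∧ h⁻¹ • x = γ • k⁻¹ • x
  let Q : X → G → G → Prop := fun x h k => x ∈ good ∧ ∃ γ : FreeGroup ι, D x h γ ∧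
    ∃ a : ι × Bool, γ.toWord.head? = some a ∧ k⁻¹ • x = (FreeGroup.mk [a])⁻¹ • h⁻¹ • x
  have hginv : ∀ x ∈ good, ∀ g : G, g⁻¹ • x ∈ good := fun x hx g => (hinv x _).2 hx
  have hΓgood : ∀ x ∈ good, ∀ γ : FreeGroup ι, γ • x ∈ good := fun x hx γ => by
    obtain ⟨g, hg⟩ := horb x hx γ
    rw [hg]
    exact (hinv x g).2 hx
  have hR1 : ∀ x h k k', R x h k → R x h k' → k = k' := fun x h k k' hk hk' =>
    he (le_antisymm (hk.2 k' hk'.1) (hk'.2 k hk.1))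
  have hGe : ∀ x ∈ good, ∀ h k : G, h⁻¹ • x = k⁻¹ • x → h = k := fun x hx h k hh =>
    inv_injective (hfG x hx hh)
  have hRex : ∀ x h, ∃ k, R x h k := by
    intro x h
    obtain ⟨k, hk, hmin⟩ := (measure e).wf.has_min
      {k | ∃ γ : FreeGroup ι, h⁻¹ • x = γ • k⁻¹ • x} ⟨h, 1, by simp⟩
    exact ⟨k, hk, fun k' hk' => not_lt.1 (hmin k' hk')⟩
  have hRcongr : ∀ x h₁ h₂ k, (∃ γ : FreeGroup ι, h₂⁻¹ • x = γ • h₁⁻¹ • x) →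
      R x h₁ k → R x h₂ k := by
    rintro x h₁ h₂ k ⟨γ, hγ⟩ ⟨⟨γ', h'⟩, hmin⟩
    refine ⟨⟨γ * γ', by rw [hγ, h', mul_smul]⟩, fun k' ⟨γ'', hk'⟩ => hmin k' ⟨γ⁻¹ * γ'', ?_⟩⟩
    rw [mul_smul, ← hk', hγ, inv_smul_smul]
  have hDuniq : ∀ x ∈ good, ∀ h γ γ', D x h γ → D x h γ' → γ = γ' := by
    rintro x hx h γ γ' ⟨k, hk, hγ⟩ ⟨k', hk', hγ'⟩
    obtain rfl := hR1 _ _ _ _ hk hk'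
    exact hfΓ _ (hginv x hx k) (hγ.symm.trans hγ')
  refine ⟨Q, ?_, ?_, ?_, ?_, ?_⟩
  · intro h k
    have hm : ∀ (γ : FreeGroup ι) (h k : G), MeasurableSet {x : X | h⁻¹ • x = γ • k⁻¹ • x} :=
      fun γ h k => measurableSet_eq_fun (hG _) ((hΓ γ).comp (hG _))
    have hme : ∀ (h k : G),
        MeasurableSet {x : X | ∃ γ : FreeGroup ι, h⁻¹ • x = γ • k⁻¹ • x} := fun h k => by
      simp only [Set.ofPred_exists]
      exact MeasurableSet.iUnion fun γ => hm γ h k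
    have hmR : ∀ h k, MeasurableSet {x | R x h k} := fun h k => by
      refine (hme h k).inter (?_ : MeasurableSet {x : X | ∀ k' : G,
        (∃ γ : FreeGroup ι, h⁻¹ • x = γ • k'⁻¹ • x) → e k ≤ e k'})
      simp only [Set.ofPred_forall]
      refine MeasurableSet.iInter fun k' => ?_
      by_cases hk : e k ≤ e k'
      · simp [hk]
      · simpa [hk, Set.compl_ofPred] using (hme h k').compl
    refine hgood.inter (?_ : MeasurableSet {x : X | ∃ γ : FreeGroup ι, D x h γ ∧
      ∃ a : ι × Bool, γ.toWord.head? = some a ∧ k⁻¹ • x = (FreeGroup.mk [a])⁻¹ • h⁻¹ • x})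
    simp only [Set.ofPred_exists]
    refine MeasurableSet.iUnion fun γ => MeasurableSet.inter (?_ : MeasurableSet {x | D x h γ})
      (?_ : MeasurableSet {x : X | ∃ a : ι × Bool, γ.toWord.head? = some a ∧
        k⁻¹ • x = (FreeGroup.mk [a])⁻¹ • h⁻¹ • x})
    · simp only [D, Set.ofPred_exists]
      exact MeasurableSet.iUnion fun k => (hmR h k).inter (hm γ h k)
    · simp only [Set.ofPred_exists]
      refine MeasurableSet.iUnion fun a => (MeasurableSet.const _).inter ?_
      exact hm _ k h
  · rintro x h k k' ⟨hx, γ, hD, a, ha, hk⟩ ⟨-, γ', hD', a', ha', hk'⟩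
    obtain rfl := hDuniq x hx _ _ _ hD hD'
    obtain rfl : a = a' := Option.some_injective _ (ha.symm.trans ha')
    exact hGe x hx _ _ (hk.trans hk'.symm)
  · rintro x g h₁ h₂ k ⟨hx, γ₁, ⟨r, hr, hγ₁⟩, a₁, ha₁, hk₁⟩ ⟨-, γ₂, ⟨r₂, hr₂, hγ₂⟩, a₂, ha₂, hk₂⟩
      hn₁ hn₂
    have h12 : h₂⁻¹ • x = (FreeGroup.mk [a₂] * (FreeGroup.mk [a₁])⁻¹) • h₁⁻¹ • x := by
      rw [mul_smul, ← hk₁, hk₂, smul_inv_smul]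
    obtain rfl := hR1 _ _ _ _ (hRcongr _ _ _ _ ⟨_, h12⟩ hr) hr₂
    obtain ⟨r', hr'⟩ := hRex (g⁻¹ • x) (g⁻¹ * h₁)
    have hcancel : ∀ h : G, (g⁻¹ * h)⁻¹ • g⁻¹ • x = h⁻¹ • x := fun h => by
      rw [← mul_smul]
      congr 1
      group
    obtain ⟨w, hw⟩ := hr'.1
    obtain ⟨u, hu⟩ : ∃ u : FreeGroup ι, r⁻¹ • x = u • r'⁻¹ • g⁻¹ • x := by
      refine ⟨γ₁⁻¹ * w, ?_⟩
      rw [mul_smul, ← hw, hcancel, hγ₁, inv_smul_smul]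
    have key : ∀ h γ a, h⁻¹ • x = γ • r⁻¹ • x → k⁻¹ • x = (FreeGroup.mk [a])⁻¹ • h⁻¹ • x →
        R (g⁻¹ • x) (g⁻¹ * h) r' → ¬ Q (g⁻¹ • x) (g⁻¹ * h) (g⁻¹ * k) →
        ((FreeGroup.mk [a])⁻¹ * γ * u).toWord.head? = some (a.1, !a.2) := by
      intro h γ a hγ hk hR hQ
      refine (FreeGroup.head?_toWord_or a _).resolve_right fun hh => hQ ?_
      refine ⟨hginv x hx g, γ * u, ⟨r', hR, ?_⟩, a, ?_, ?_⟩
      · rw [hcancel, hγ, hu, mul_smul]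
      · rw [← hh]
        congr 2
        group
      · rw [hcancel, hcancel, hk]
    have hr'2 : R (g⁻¹ • x) (g⁻¹ * h₂) r' :=
      hRcongr _ _ _ _ ⟨_, by rw [hcancel, hcancel, h12]⟩ hr'
    have e1 := key h₁ γ₁ a₁ hγ₁ hk₁ hr' hn₁
    have e2 := key h₂ γ₂ a₂ hγ₂ hk₂ hr'2 hn₂
    have ht : (FreeGroup.mk [a₁])⁻¹ * γ₁ = (FreeGroup.mk [a₂])⁻¹ * γ₂ := by
      apply hfΓ _ (hginv x hx r)
      show ((FreeGroup.mk [a₁])⁻¹ * γ₁) • r⁻¹ • x = ((FreeGroup.mk [a₂])⁻¹ * γ₂) • r⁻¹ • x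
      rw [mul_smul, mul_smul, ← hγ₁, ← hγ₂, ← hk₁, ← hk₂]
    rw [ht, e2] at e1
    have ha : a₁ = a₂ := by
      have := Option.some_injective _ e1
      simp only [Prod.mk.injEq] at this
      exact Prod.ext this.1.symm (by simpa using this.2.symm)
    apply hGe x hx
    have := hk₁.symm.trans hk₂
    rw [ha] at this
    exact smul_left_cancel _ this
  · rintro x k ⟨hx, γ, ⟨r, hr, hγ⟩, a, ha, -⟩
    have : R x 1 1 := ⟨⟨1, by simp⟩, fun k' _ => by rw [he1]; exact Nat.zero_le _⟩
    obtain rfl := hR1 _ _ _ _ hr this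
    have h1 : γ = 1 := by
      apply hfΓ x hx
      simpa using hγ.symm
    simp [h1] at ha
  · intro x hx i h hh
    refine ⟨hx, FreeGroup.of i, ⟨1, ⟨⟨FreeGroup.of i, by simpa using hh⟩, fun k' _ => ?_⟩,
      by simpa using hh⟩, (i, true), by simp, ?_⟩
    · rw [he1]
      exact Nat.zero_le _
    · rw [hh]
      show _ = (FreeGroup.of i)⁻¹ • _
      rw [inv_smul_smul]
      simp

/-- The action of `ℤ` on the free group on `ℤ` by shifting the generators. -/
def freeGroupShift : Multiplicative ℤ →* MulAut (FreeGroup ℤ) where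
  toFun n := FreeGroup.freeGroupCongr (Equiv.addLeft n.toAdd)
  map_one' := by
    ext x
    simp
  map_mul' m n := by
    ext x
    simp only [MulAut.mul_apply]
    induction x using FreeGroup.induction_on with
    | C1 => simp
    | of i => simp [add_assoc]
    | inv_of i h => rw [map_inv, h, map_inv, map_inv]
    | mul a b ha hb => rw [map_mul, ha, hb, map_mul, map_mul]

theorem exists_injective_freeGroup_int_hom :
    ∃ f : FreeGroup ℤ →* FreeGroup (Fin 2), Function.Injective f := by
  let f : FreeGroup ℤ →* FreeGroup (Fin 2) := FreeGroup.lift fun n =>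
    FreeGroup.of 0 ^ n * FreeGroup.of 1 * (FreeGroup.of 0 ^ n)⁻¹
  let p : FreeGroup (Fin 2) →* FreeGroup ℤ ⋊[freeGroupShift] Multiplicative ℤ := FreeGroup.lift
    ![SemidirectProduct.inr (Multiplicative.ofAdd 1), SemidirectProduct.inl (FreeGroup.of 0)]
  have h : p.comp f = SemidirectProduct.inl := by
    ext1 n
    simp only [MonoidHom.comp_apply, f, p, FreeGroup.lift_apply_of, map_mul, map_inv, map_zpow,
      Matrix.cons_val_zero, Matrix.cons_val_one]
    rw [← map_zpow, ← map_inv, ← SemidirectProduct.inl_aut]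
    congr 1
    simp [freeGroupShift]
  refine ⟨f, fun x y hxy => ?_⟩
  have := DFunLike.congr_fun h x
  rw [MonoidHom.comp_apply, hxy, ← MonoidHom.comp_apply, h] at this
  exact (SemidirectProduct.inl_injective this).symm

theorem ae_prod_count_iff {X G : Type} [MeasurableSpace X] {μ : Measure X} [Countable G]
    [MeasurableSpace G] [MeasurableSingletonClass G] {P : X × G → Prop} :
    (∀ᵐ p ∂(μ.prod Measure.count), P p) ↔ ∀ᵐ x ∂μ, ∀ h, P (x, h) := by
  constructor
  · intro hP
    filter_upwards [Measure.ae_ae_of_ae_prod hP] with x hx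
    exact Measure.ae_count_iff.1 hx
  · intro hP
    have hsub : {p | ¬ P p} ⊆ ⋃ h : G, {x | ¬ P (x, h)} ×ˢ {h} := fun p hp =>
      Set.mem_iUnion.2 ⟨p.2, hp, rfl⟩
    refine measure_mono_null hsub (measure_iUnion_null fun h => ?_)
    rw [Measure.prod_prod, ae_iff.1 (ae_all_iff.1 hP h), zero_mul]

section WeightedSubstitution

variable {X G : Type} [MeasurableSpace X] {μ : Measure X} [Countable G]
  [MeasurableSpace G] [DiscreteMeasurableSpace G]

theorem enorm_weighted_substitution_le {S : X → X} (hS : MeasurePreserving S μ μ)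
    {θ : X → G → G} (hθ : ∀ h, Measurable fun x => θ x h) {m : X → G → ℂ}
    {c : NNReal} (hc : ∀ x h, ‖m x h‖ ≤ c)
    (hinj : ∀ x, Set.InjOn (θ x) {h | m x h ≠ 0}) {f : X × G → ℂ} (hf : Measurable f)
    (hm : ∀ h, Measurable fun x => m x h) :
    eLpNorm (fun p : X × G => m p.1 p.2 * f (S p.1, θ p.1 p.2)) 2 (μ.prod Measure.count) ≤
      c * eLpNorm f 2 (μ.prod Measure.count) := by
  have hθ' : Measurable fun p : X × G => (S p.1, θ p.1 p.2) :=
    (hS.measurable.comp measurable_fst).prodMk (measurable_from_prod_countable_left hθ)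
  have hm' : Measurable fun p : X × G => m p.1 p.2 := measurable_from_prod_countable_left hm
  have hsq : ∀ u : X × G → ℂ, Measurable u → eLpNorm u 2 (μ.prod Measure.count) ^ 2 =
      ∫⁻ x, ∑' h, ‖u (x, h)‖ₑ ^ 2 ∂μ := by
    intro u hu
    have := eLpNorm_nnreal_pow_eq_lintegral (f := u) (μ := μ.prod Measure.count)
      (p := 2) two_ne_zero
    have h2 : ((2 : NNReal) : ENNReal) = 2 := rfl
    have h2' : ((2 : NNReal) : ℝ) = (2 : ℕ) := rfl
    rw [h2, h2'] at this
    simp only [ENNReal.rpow_natCast] at this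
    rw [this, lintegral_prod _ (hu.enorm.pow_const 2).aemeasurable]
    simp only [lintegral_count]
  have hfS : ∫⁻ x, ∑' h, ‖f (S x, h)‖ₑ ^ 2 ∂μ = ∫⁻ x, ∑' h, ‖f (x, h)‖ₑ ^ 2 ∂μ :=
    hS.lintegral_comp (f := fun x => ∑' h, ‖f (x, h)‖ₑ ^ 2) (by fun_prop)
  refine (ENNReal.pow_le_pow_left_iff two_ne_zero).1 ?_
  rw [mul_pow, hsq (fun p => m p.1 p.2 * f (S p.1, θ p.1 p.2)) (hm'.mul (hf.comp hθ')),
    hsq f hf, ← hfS,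
    ← lintegral_const_mul _ (by have := hS.measurable; fun_prop)]
  refine lintegral_mono fun x => ?_
  calc ∑' h, ‖m x h * f (S x, θ x h)‖ₑ ^ 2
      = ∑' h : {h | m x h ≠ 0}, ‖m x h * f (S x, θ x h)‖ₑ ^ 2 := by
        rw [tsum_subtype {h | m x h ≠ 0} fun h => ‖m x h * f (S x, θ x h)‖ₑ ^ 2]
        congr with h
        by_cases hh : m x h = 0 <;> simp [hh]
    _ ≤ ∑' h : {h | m x h ≠ 0}, (c : ENNReal) ^ 2 * ‖f (S x, θ x h)‖ₑ ^ 2 := by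
        refine ENNReal.tsum_le_tsum fun h => ?_
        rw [enorm_mul, mul_pow]
        gcongr
        rw [enorm_le_coe]
        exact hc x h
    _ = c ^ 2 * ∑' h : {h | m x h ≠ 0}, ‖f (S x, θ x h)‖ₑ ^ 2 := ENNReal.tsum_mul_left
    _ ≤ c ^ 2 * ∑' k, ‖f (S x, k)‖ₑ ^ 2 := by
        gcongr
        exact ENNReal.tsum_comp_le_tsum_of_injective (hinj x).injective
          fun k => ‖f (S x, k)‖ₑ ^ 2

/-- Weighted substitution operators on `L²(X × G)`. -/
theorem exists_weighted_substitution {S : X → X} (hS : MeasurePreserving S μ μ)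
    {θ : X → G → G} (hθ : ∀ h, Measurable fun x => θ x h) {m : X → G → ℂ}
    (hm : ∀ h, Measurable fun x => m x h) (c : NNReal) (hc : ∀ x h, ‖m x h‖ ≤ c)
    (hinj : ∀ x, Set.InjOn (θ x) {h | m x h ≠ 0}) :
    ∃ L : Lp ℂ 2 (μ.prod (Measure.count : Measure G)) →L[ℂ]
        Lp ℂ 2 (μ.prod (Measure.count : Measure G)), ‖L‖ ≤ c ∧
      ∀ f, ∀ᵐ x ∂μ, ∀ h, L f (x, h) = m x h * f (S x, θ x h) := by
  have hθ' : Measurable fun p : X × G => (S p.1, θ p.1 p.2) :=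
    (hS.measurable.comp measurable_fst).prodMk (measurable_from_prod_countable_left hθ)
  have hm' : Measurable fun p : X × G => m p.1 p.2 := measurable_from_prod_countable_left hm
  have hmem : ∀ f : Lp ℂ 2 (μ.prod (Measure.count : Measure G)),
      MemLp (fun p : X × G => m p.1 p.2 * f (S p.1, θ p.1 p.2)) 2 (μ.prod Measure.count) :=
    fun f => ⟨(hm'.mul ((Lp.stronglyMeasurable f).measurable.comp hθ')).aestronglyMeasurable,
      (enorm_weighted_substitution_le hS hθ hc hinj
        (Lp.stronglyMeasurable f).measurable hm).trans_lt
        (ENNReal.mul_lt_top ENNReal.coe_lt_top (Lp.eLpNorm_lt_top f))⟩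
  have hae : ∀ {P : X × G → Prop}, (∀ᵐ p ∂(μ.prod Measure.count), P p) →
      ∀ᵐ p ∂(μ.prod (Measure.count : Measure G)), P (S p.1, θ p.1 p.2) := by
    intro P hP
    rw [ae_prod_count_iff] at hP ⊢
    filter_upwards [hS.quasiMeasurePreserving.ae hP] with x hx h
    exact hx _
  let L₀ : Lp ℂ 2 (μ.prod (Measure.count : Measure G)) →ₗ[ℂ]
      Lp ℂ 2 (μ.prod (Measure.count : Measure G)) :=
    { toFun := fun f => (hmem f).toLp _
      map_add' := fun f g => by
        rw [← MemLp.toLp_add]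
        refine MemLp.toLp_congr _ _ ?_
        filter_upwards [hae (Lp.coeFn_add f g)] with p hp
        simp only [hp, Pi.add_apply, mul_add]
      map_smul' := fun a f => by
        rw [RingHom.id_apply, ← MemLp.toLp_const_smul]
        refine MemLp.toLp_congr _ _ ?_
        filter_upwards [hae (Lp.coeFn_smul a f)] with p hp
        simp only [hp, Pi.smul_apply, smul_eq_mul]
        ring }
  refine ⟨L₀.mkContinuous c fun f => ?_, LinearMap.mkContinuous_norm_le _ c.2 _, fun f => ?_⟩
  · show ‖(hmem f).toLp _‖ ≤ _
    rw [Lp.norm_toLp, Lp.norm_def]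
    refine (ENNReal.toReal_mono ?_ (enorm_weighted_substitution_le hS hθ hc hinj
      (Lp.stronglyMeasurable f).measurable hm)).trans_eq ?_
    · exact (ENNReal.mul_lt_top ENNReal.coe_lt_top (Lp.eLpNorm_lt_top f)).ne
    · rw [ENNReal.toReal_mul, ENNReal.coe_toReal]
  · exact ae_prod_count_iff.1 (hmem f).coeFn_toLp

end WeightedSubstitution

section ForestDerivation

variable {N G X : Type} [Group N] [Group G] [MulAction G X] {φ : G →* MulAut N}

/-- The twisted translation action of `N ⋊ G` on functions on `X × G`. -/
noncomputable def twistedTranslation (χ : N →* (X → Circle)) (s : N ⋊[φ] G) (u : X × G → ℂ) :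
    X × G → ℂ :=
  fun p => χ s.left p.1 * u (s.right⁻¹ • p.1, s.right⁻¹ * p.2)

theorem twistedTranslation_mul {χ : N →* (X → Circle)}
    (hχ : ∀ g n x, χ (φ g n) x = χ n (g⁻¹ • x)) (s t : N ⋊[φ] G) (u : X × G → ℂ) :
    twistedTranslation χ (s * t) u = twistedTranslation χ s (twistedTranslation χ t u) := by
  funext p
  simp only [twistedTranslation, SemidirectProduct.mul_left, SemidirectProduct.mul_right, map_mul,
    Pi.mul_apply, Circle.coe_mul, hχ, mul_inv_rev, mul_smul, mul_assoc]

open Classical in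
/-- Composition with a partially defined map `h ↦ k` given by the relation `Q x h k`. -/
noncomputable def parentOp (Q : X → G → G → Prop) (u : X × G → ℂ) : X × G → ℂ :=
  fun p => if h : ∃ k, Q p.1 p.2 k then u (p.1, h.choose) else 0

open Classical in
theorem exists_forest_derivation [MeasurableSpace X] {μ : Measure X} [Countable G]
    [MeasurableSpace G] [DiscreteMeasurableSpace G]
    (hG : ∀ g : G, MeasurePreserving (fun x : X => g • x) μ μ)
    (χ : N →* (X → Circle)) (hχm : ∀ n, Measurable (χ n))
    (hχ : ∀ g n x, χ (φ g n) x = χ n (g⁻¹ • x))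
    (Q : X → G → G → Prop) (hQm : ∀ h k, MeasurableSet {x | Q x h k})
    (hQu : ∀ x h k k', Q x h k → Q x h k' → k = k')
    (hQb : ∀ x g h₁ h₂ k, Q x h₁ k → Q x h₂ k → ¬ Q (g⁻¹ • x) (g⁻¹ * h₁) (g⁻¹ * k) →
        ¬ Q (g⁻¹ • x) (g⁻¹ * h₂) (g⁻¹ * k) → h₁ = h₂) :
    ∃ (ρ : N ⋊[φ] G →* (Lp ℂ 2 (μ.prod (Measure.count : Measure G)) →L[ℂ]
        Lp ℂ 2 (μ.prod (Measure.count : Measure G))))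
      (δ : N ⋊[φ] G → (Lp ℂ 2 (μ.prod (Measure.count : Measure G)) →L[ℂ]
        Lp ℂ 2 (μ.prod (Measure.count : Measure G)))),
      (∀ s t, δ (s * t) = ρ s * δ t + δ s * ρ t) ∧ (∀ s, ‖ρ s‖ ≤ 1) ∧ (∀ s, ‖δ s‖ ≤ 2) ∧
      (∀ s f, ∀ᵐ x ∂μ, ∀ h, ρ s f (x, h) = twistedTranslation χ s f (x, h)) ∧
      ∀ s f, ∀ᵐ x ∂μ, ∀ h, δ s f (x, h) =
        parentOp Q (twistedTranslation χ s f) (x, h) -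
          twistedTranslation χ s (parentOp Q f) (x, h) := by
  have hext : ∀ {f g : Lp ℂ 2 (μ.prod (Measure.count : Measure G))},
      (∀ᵐ x ∂μ, ∀ h, f (x, h) = g (x, h)) → f = g := fun {f g} h =>
    Lp.ext (ae_prod_count_iff.2 h)
  have hχm' : ∀ n, Measurable fun x => ((χ n x : Circle) : ℂ) := fun n =>
    (by fun_prop : Continuous fun z : Circle => (z : ℂ)).measurable.comp (hχm n)
  have hcoe : ∀ {u v : X × G → ℂ}, (∀ᵐ p ∂(μ.prod (Measure.count : Measure G)), u p = v p) →
      ∀ᵐ x ∂μ, ∀ h, u (x, h) = v (x, h) := fun h => ae_prod_count_iff.1 h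
  have hTcongr : ∀ (s : N ⋊[φ] G) {u v : X × G → ℂ}, (∀ᵐ x ∂μ, ∀ h, u (x, h) = v (x, h)) →
      ∀ᵐ x ∂μ, ∀ h, twistedTranslation χ s u (x, h) = twistedTranslation χ s v (x, h) := by
    intro s u v h
    filter_upwards [(hG s.right⁻¹).quasiMeasurePreserving.ae h] with x hx h
    simp only [twistedTranslation, hx]
  have hPcongr : ∀ {u v : X × G → ℂ}, (∀ᵐ x ∂μ, ∀ h, u (x, h) = v (x, h)) →
      ∀ᵐ x ∂μ, ∀ h, parentOp Q u (x, h) = parentOp Q v (x, h) := by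
    intro u v h
    filter_upwards [h] with x hx h
    simp only [parentOp, hx]
  choose ρ hρ1 hρ₀ using fun s : N ⋊[φ] G => exists_weighted_substitution (G := G) (hG s.right⁻¹)
    (θ := fun _ h => s.right⁻¹ * h) (fun _ => measurable_const) (m := fun x _ => χ s.left x)
    (fun _ => hχm' _) 1 (fun x h => (Circle.norm_coe _).le) (fun x => (mul_right_injective _).injOn)
  have hρ : ∀ s f, ∀ᵐ x ∂μ, ∀ h, ρ s f (x, h) = twistedTranslation χ s f (x, h) := hρ₀
  let τ : X → G → G := fun x h => if hk : ∃ k, Q x h k then hk.choose else 1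
  have hτ : ∀ {x h k}, Q x h k → τ x h = k := fun {x h k} hk => by
    have hk' : ∃ k, Q x h k := ⟨k, hk⟩
    simp only [τ, dif_pos hk']
    exact hQu _ _ _ _ hk'.choose_spec hk
  have hQe : ∀ h, MeasurableSet {x | ∃ k, Q x h k} := fun h => by
    simp only [Set.ofPred_exists]
    exact MeasurableSet.iUnion fun k => hQm h k
  have hτm : ∀ h, Measurable fun x => τ x h := fun h => by
    refine measurable_to_countable' fun k => ?_
    have : (fun x => τ x h) ⁻¹' {k} =
        {x | Q x h k} ∪ ({x | ∃ k, Q x h k}ᶜ ∩ {_x | k = 1}) := by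
      ext x
      simp only [Set.mem_preimage, Set.mem_singleton_iff, Set.mem_union, Set.mem_inter_iff,
        Set.mem_compl_iff, Set.mem_ofPred_eq]
      by_cases hk : ∃ k, Q x h k
      · obtain ⟨k', hk'⟩ := hk
        rw [hτ hk']
        constructor
        · rintro rfl
          exact Or.inl hk'
        · rintro (h1 | h1)
          · exact hQu _ _ _ _ hk' h1
          · exact absurd ⟨k', hk'⟩ h1.1
      · have : τ x h = 1 := dif_neg hk
        rw [this]
        constructor
        · exact fun h1 => Or.inr ⟨hk, h1.symm⟩
        · rintro (h1 | h1)
          · exact absurd ⟨k, h1⟩ hk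
          · exact h1.2.symm
    rw [this]
    exact (hQm h k).union ((hQe h).compl.inter (MeasurableSet.const _))
  let P : G → X → G → Prop := fun g x h => ∃ k, Q x h k ∧ Q (g⁻¹ • x) (g⁻¹ * h) (g⁻¹ * k)
  have hPm : ∀ g h, MeasurableSet {x | P g x h} := fun g h => by
    simp only [P, Set.ofPred_exists]
    exact MeasurableSet.iUnion fun k => (hQm h k).inter ((hG g⁻¹).measurable (hQm _ _))
  have hind : ∀ (s : Set X) n x, ‖s.indicator (fun x => ((χ n x : Circle) : ℂ)) x‖ ≤ 1 :=
    fun s n x => (norm_indicator_le_norm_self _ _).trans (Circle.norm_coe _).le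
  choose δ₁ hδ₁1 hδ₁ using fun s : N ⋊[φ] G => exists_weighted_substitution (G := G) (hG s.right⁻¹)
    (θ := fun x h => s.right⁻¹ * τ x h)
    (fun h => (Measurable.of_discrete (f := fun k => s.right⁻¹ * k)).comp (hτm h))
    (m := fun x h => ({x | (∃ k, Q x h k)} ∩ {x | P s.right x h}ᶜ).indicator
      (fun x => (χ s.left x : ℂ)) x)
    (fun h => (hχm' _).indicator ((hQe h).inter (hPm _ h).compl)) 1
    (fun x h => hind _ _ _) (fun x h₁ hh₁ h₂ hh₂ h12 => by
      obtain ⟨⟨k, hk⟩, hn⟩ := Set.mem_of_indicator_ne_zero hh₁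
      obtain ⟨⟨k', hk'⟩, hn'⟩ := Set.mem_of_indicator_ne_zero hh₂
      have h12 := mul_left_cancel h12
      rw [hτ hk, hτ hk'] at h12
      subst h12
      exact hQb x s.right h₁ h₂ k hk hk' (fun h => hn ⟨k, hk, h⟩) (fun h => hn' ⟨k, hk', h⟩))
  choose δ₂ hδ₂1 hδ₂ using fun s : N ⋊[φ] G => exists_weighted_substitution (G := G) (hG s.right⁻¹)
    (θ := fun x h => τ (s.right⁻¹ • x) (s.right⁻¹ * h))
    (fun h => (hτm _).comp (hG s.right⁻¹).measurable)
    (m := fun x h => (((fun x => s.right⁻¹ • x) ⁻¹' {x | (∃ k, Q x (s.right⁻¹ * h) k)}) ∩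
      {x | P s.right x h}ᶜ).indicator (fun x => (χ s.left x : ℂ)) x)
    (fun h => (hχm' _).indicator (((hG s.right⁻¹).measurable (hQe _)).inter (hPm _ h).compl)) 1
    (fun x h => hind _ _ _) (fun x h₁ hh₁ h₂ hh₂ h12 => by
      obtain ⟨⟨k, hk⟩, hn⟩ := Set.mem_of_indicator_ne_zero hh₁
      obtain ⟨⟨k', hk'⟩, hn'⟩ := Set.mem_of_indicator_ne_zero hh₂
      have h12 : τ (s.right⁻¹ • x) (s.right⁻¹ * h₁) = τ (s.right⁻¹ • x) (s.right⁻¹ * h₂) := h12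
      rw [hτ hk, hτ hk'] at h12
      subst h12
      have hb := hQb (s.right⁻¹ • x) s.right⁻¹ _ _ k hk hk'
      simp only [inv_inv, smul_inv_smul, mul_inv_cancel_left] at hb
      exact mul_left_cancel (hb (fun h => hn ⟨_, h, by simpa using hk⟩)
        (fun h => hn' ⟨_, h, by simpa using hk'⟩)))
  have hδ : ∀ s f, ∀ᵐ x ∂μ, ∀ h, (δ₁ s - δ₂ s) f (x, h) =
        parentOp Q (twistedTranslation χ s f) (x, h) -
          twistedTranslation χ s (parentOp Q f) (x, h) := by
    intro s f
    filter_upwards [hδ₁ s f, hδ₂ s f, hcoe (Lp.coeFn_sub (δ₁ s f) (δ₂ s f))] with x h1 h2 h3 h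
    rw [sub_apply, h3, Pi.sub_apply, h1, h2]
    have e1 : parentOp Q (twistedTranslation χ s f) (x, h) = if ∃ k, Q x h k then
        χ s.left x * f (s.right⁻¹ • x, s.right⁻¹ * τ x h) else 0 := by
      by_cases hk : ∃ k, Q x h k <;> simp [parentOp, twistedTranslation, τ, hk]
    have e2 : twistedTranslation χ s (parentOp Q f) (x, h) =
        if ∃ k, Q (s.right⁻¹ • x) (s.right⁻¹ * h) k then
        χ s.left x * f (s.right⁻¹ • x, τ (s.right⁻¹ • x) (s.right⁻¹ * h)) else 0 := by
      by_cases hk : ∃ k, Q (s.right⁻¹ • x) (s.right⁻¹ * h) k <;>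
        simp [parentOp, twistedTranslation, τ, hk]
    rw [e1, e2]
    simp only [Set.indicator_apply, Set.mem_inter_iff, Set.mem_compl_iff, Set.mem_ofPred_eq,
      Set.mem_preimage]
    by_cases hP : P s.right x h
    · obtain ⟨k, hk, hk'⟩ := id hP
      have h1' : ∃ k, Q x h k := ⟨k, hk⟩
      have h2' : ∃ k, Q (s.right⁻¹ • x) (s.right⁻¹ * h) k := ⟨_, hk'⟩
      simp only [hP, h1', h2', hτ hk, hτ hk']
      simp
    · simp only [hP, not_false_eq_true, and_true, ite_mul, zero_mul]
  have hρmul : ∀ s t, ρ (s * t) = ρ s * ρ t := fun s t => by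
    ext1 f
    refine hext ?_
    filter_upwards [hρ (s * t) f, hρ s (ρ t f), hTcongr s (hρ t f)] with x h1 h2 h3 h
    change _ = (ρ s (ρ t f) : Lp ℂ 2 _) (x, h)
    rw [h1, h2]
    exact (congrFun (twistedTranslation_mul hχ s t f) (x, h)).trans (h3 h).symm
  refine ⟨{ toFun := ρ, map_one' := ?_, map_mul' := hρmul }, fun s => δ₁ s - δ₂ s, ?_, hρ1,
    ?_, hρ, hδ⟩
  · ext1 f
    refine hext ?_
    filter_upwards [hρ 1 f] with x h1 h
    rw [h1]
    simp [twistedTranslation]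
  · intro s t
    ext1 f
    refine hext ?_
    have hs : ∀ u v : X × G → ℂ, twistedTranslation χ s (u - v) =
        twistedTranslation χ s u - twistedTranslation χ s v := fun u v => by
      funext p
      simp [twistedTranslation, mul_sub]
    filter_upwards [hδ (s * t) f, hρ s ((δ₁ t - δ₂ t) f),
      hTcongr s (v := parentOp Q (twistedTranslation χ t f) - twistedTranslation χ t (parentOp Q f))
        (hδ t f), hδ s (ρ t f), hPcongr (hTcongr s (hρ t f)), hTcongr s (hPcongr (hρ t f)),
      hcoe (Lp.coeFn_add (ρ s ((δ₁ t - δ₂ t) f)) ((δ₁ s - δ₂ s) (ρ t f)))]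
      with x h1 h2 h3 h4 h5 h6 h7 h
    change _ = (ρ s ((δ₁ t - δ₂ t) f) + (δ₁ s - δ₂ s) (ρ t f) : Lp ℂ 2 _) (x, h)
    rw [h1, h7, Pi.add_apply, h2, h3, h4, hs, twistedTranslation_mul hχ, twistedTranslation_mul hχ]
    have h5' := h5 h
    have h6' := h6 h
    simp only [Pi.sub_apply]
    rw [h5']
    have : twistedTranslation χ s (parentOp Q (ρ t f)) (x, h) =
      twistedTranslation χ s (parentOp Q (twistedTranslation χ t f)) (x, h) := h6'
    rw [this]
    ring
  · intro s
    refine (norm_sub_le _ _).trans ((add_le_add (hδ₁1 s) (hδ₂1 s)).trans_eq ?_)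
    norm_num

end ForestDerivation

theorem exists_wreath_characters {A G X : Type} [CommGroup A] [Group G] [MulAction G X]
    [MeasurableSpace X] (hG : ∀ g : G, Measurable fun x : X => g • x)
    (φ : A →* (X → Circle)) (hφ : ∀ a, Measurable (φ a)) :
    ∃ χ : finSupp G A →* (X → Circle), (∀ n, Measurable (χ n)) ∧
      (∀ g n x, χ (shiftHom A G g n) x = χ n (g⁻¹ • x)) ∧
      ∀ a, ∃ n, χ n = φ a := by
  classical
  have hfin : ∀ (n : finSupp G A) x,
      (Function.mulSupport fun k : G => φ ((n : G → A) k) (k⁻¹ • x)).Finite := fun n x =>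
    n.2.subset fun k hk h => hk (by simp [h])
  let χ : finSupp G A →* (X → Circle) :=
    { toFun := fun n x => ∏ᶠ k : G, φ ((n : G → A) k) (k⁻¹ • x)
      map_one' := by
        funext x
        simp
      map_mul' := fun n n' => by
        funext x
        rw [Pi.mul_apply, ← finprod_mul_distrib (hfin n x) (hfin n' x)]
        simp }
  refine ⟨χ, fun n => ?_, fun g n x => ?_, fun a => ?_⟩
  · have hn : {k | (n : G → A) k ≠ 1}.Finite := n.2
    have : χ n = fun x => ∏ k ∈ hn.toFinset, φ ((n : G → A) k) (k⁻¹ • x) := by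
      funext x
      refine finprod_eq_prod_of_mulSupport_subset _ fun k hk => ?_
      rw [Set.Finite.coe_toFinset]
      exact fun h => hk (by simp [h])
    rw [this]
    exact Finset.measurable_prod _ fun k _ => (hφ _).comp (hG _)
  · show ∏ᶠ k : G, φ ((n : G → A) (g⁻¹ * k)) (k⁻¹ • x) =
      ∏ᶠ k : G, φ ((n : G → A) k) (k⁻¹ • g⁻¹ • x)
    rw [← finprod_comp_equiv (Equiv.mulLeft g)]
    simp [mul_smul]
  · refine ⟨⟨Pi.mulSingle 1 a, (Set.finite_singleton 1).subset fun k hk => ?_⟩, funext fun x => ?_⟩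
    · by_contra h
      exact hk (Pi.mulSingle_eq_of_ne h _)
    · show ∏ᶠ k : G, φ ((Pi.mulSingle 1 a : G → A) k) (k⁻¹ • x) = φ a x
      rw [finprod_eq_single _ (1 : G) fun k hk => by simp [Pi.mulSingle_eq_of_ne hk]]
      simp

open scoped BoundedContinuousFunction

theorem setIntegral_eq_zero_of_starSubalgebra_real {Y Z : Type} [MeasurableSpace Y] {ν : Measure Y}
    [TopologicalSpace Z] [PolishSpace Z] [MeasurableSpace Z] [BorelSpace Z] {ψ : Y → Z}
    (hψ : Measurable ψ) {𝒮 : StarSubalgebra ℂ (Z →ᵇ ℂ)}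
    (hsep : (𝒮.map (BoundedContinuousFunction.toContinuousMapStarₐ ℂ)).SeparatesPoints)
    {u : Y → ℝ} (hu : Integrable u ν) (h : ∀ s ∈ 𝒮, ∫ y, s (ψ y) * (u y : ℂ) ∂ν = 0)
    {E : Set Z} (hE : MeasurableSet E) : ∫ y in ψ ⁻¹' E, u y ∂ν = 0 := by
  have key : ∀ v : Y → ℝ, Integrable v ν → ∀ s : Z →ᵇ ℂ,
      ∫ z, s z ∂((ν.withDensity fun y => ENNReal.ofReal (v y)).map ψ) =
        ∫ y, s (ψ y) * ((max (v y) 0 : ℝ) : ℂ) ∂ν := fun v hv s => by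
    rw [integral_map hψ.aemeasurable s.continuous.measurable.aestronglyMeasurable,
      integral_withDensity_eq_integral_toReal_smul₀ hv.1.aemeasurable.ennreal_ofReal
        (Filter.Eventually.of_forall fun _ => ENNReal.ofReal_lt_top)]
    refine integral_congr_ae (Filter.Eventually.of_forall fun y => ?_)
    simp only [ENNReal.toReal_ofReal', Complex.real_smul]
    ring
  have hint : ∀ v : Y → ℝ, Integrable v ν → ∀ s : Z →ᵇ ℂ,
      Integrable (fun y => s (ψ y) * ((max (v y) 0 : ℝ) : ℂ)) ν := fun v hv s =>
    (hv.pos_part.ofReal (𝕜 := ℂ)).bdd_mul (c := ‖s‖)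
      (s.continuous.measurable.comp hψ).aestronglyMeasurable
      (Filter.Eventually.of_forall fun y => s.norm_coe_le_norm _)
  have hfin : ∀ v : Y → ℝ, Integrable v ν →
      IsFiniteMeasure ((ν.withDensity fun y => ENNReal.ofReal (v y)).map ψ) := fun v hv => by
    have := isFiniteMeasure_withDensity_ofReal hv.2
    infer_instance
  have hun : Integrable (fun y => -u y) ν := hu.neg
  have h1 := hfin u hu
  have h2 := hfin (fun y => -u y) hun
  have hP := ext_of_forall_mem_subalgebra_integral_eq_of_polish hsep
    (P := (ν.withDensity fun y => ENNReal.ofReal (u y)).map ψ)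
    (P' := (ν.withDensity fun y => ENNReal.ofReal (-u y)).map ψ) fun s hs => by
      rw [key u hu, key (fun y => -u y) hun, ← sub_eq_zero,
        ← integral_sub (hint u hu s) (hint (fun y => -u y) hun s),
        ← h s hs]
      refine integral_congr_ae (Filter.Eventually.of_forall fun y => ?_)
      simp only [← mul_sub, ← Complex.ofReal_sub, max_zero_sub_eq_self]
  rw [integral_eq_lintegral_pos_part_sub_lintegral_neg_part hu.integrableOn,
    ← withDensity_apply _ (hψ hE), ← withDensity_apply _ (hψ hE), ← Measure.map_apply hψ hE,
    ← Measure.map_apply hψ hE, hP, sub_self]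

theorem setIntegral_eq_zero_of_starSubalgebra {Y Z : Type} [MeasurableSpace Y] {ν : Measure Y}
    [TopologicalSpace Z] [PolishSpace Z] [MeasurableSpace Z] [BorelSpace Z] {ψ : Y → Z}
    (hψ : Measurable ψ) {𝒮 : StarSubalgebra ℂ (Z →ᵇ ℂ)}
    (hsep : (𝒮.map (BoundedContinuousFunction.toContinuousMapStarₐ ℂ)).SeparatesPoints)
    {F : Y → ℂ} (hF : Integrable F ν) (h : ∀ s ∈ 𝒮, ∫ y, s (ψ y) * F y ∂ν = 0)
    {E : Set Z} (hE : MeasurableSet E) : ∫ y in ψ ⁻¹' E, F y ∂ν = 0 := by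
  have hint : ∀ (f : Y → ℂ), Integrable f ν → ∀ s : Z →ᵇ ℂ,
      Integrable (fun y => s (ψ y) * f y) ν := fun f hf s =>
    hf.bdd_mul (c := ‖s‖) (s.continuous.measurable.comp hψ).aestronglyMeasurable
      (Filter.Eventually.of_forall fun y => s.norm_coe_le_norm _)
  have hconj : ∀ s ∈ 𝒮, ∫ y, s (ψ y) * starRingEnd ℂ (F y) ∂ν = 0 := fun s hs => by
    have := congrArg (starRingEnd ℂ) (h (star s) (star_mem hs))
    rw [← integral_conj, map_zero] at this
    rw [← this]
    refine integral_congr_ae (Filter.Eventually.of_forall fun y => ?_)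
    simp
  have hFc : Integrable (fun y => starRingEnd ℂ (F y)) ν :=
    (Complex.conjLIE.toContinuousLinearEquiv : ℂ →L[ℝ] ℂ).integrable_comp hF
  have hre : ∫ y in ψ ⁻¹' E, (F y).re ∂ν = 0 :=
    setIntegral_eq_zero_of_starSubalgebra_real hψ hsep hF.re (fun s hs => by
      have : ∫ y, (s (ψ y) * F y + s (ψ y) * starRingEnd ℂ (F y)) / 2 ∂ν = 0 := by
        rw [integral_div, integral_add (hint _ hF s) (hint _ hFc s), h s hs, hconj s hs]
        simp
      rw [← this]
      refine integral_congr_ae (Filter.Eventually.of_forall fun y => ?_)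
      simp only [← mul_add, Complex.add_conj, RCLike.re_eq_complex_re]
      push_cast
      ring) hE
  have him : ∫ y in ψ ⁻¹' E, (F y).im ∂ν = 0 :=
    setIntegral_eq_zero_of_starSubalgebra_real hψ hsep hF.im (fun s hs => by
      have : ∫ y, (s (ψ y) * F y - s (ψ y) * starRingEnd ℂ (F y)) / (2 * Complex.I) ∂ν = 0 := by
        rw [integral_div, integral_sub (hint _ hF s) (hint _ hFc s), h s hs, hconj s hs]
        simp
      rw [← this]
      refine integral_congr_ae (Filter.Eventually.of_forall fun y => ?_)
      simp only [← mul_sub, Complex.sub_conj, RCLike.im_eq_complex_im]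
      have := Complex.I_ne_zero
      push_cast
      field_simp) hE
  have := integral_re_add_im (𝕜 := ℂ) (hF.integrableOn (s := ψ ⁻¹' E))
  simp only [RCLike.re_eq_complex_re, RCLike.im_eq_complex_im] at this
  rw [← this, hre, him]
  simp

section CommutesWithMul

variable {Y : Type} [MeasurableSpace Y] {ν : Measure Y}

/-- A bounded operator on `L²` commutes with the multiplication by the function `m`. -/
def CommutesWithMul (q : Lp ℂ 2 ν →L[ℂ] Lp ℂ 2 ν) (m : Y → ℂ) : Prop :=
  ∀ ξ η : Lp ℂ 2 ν, (∀ᵐ y ∂ν, η y = m y * ξ y) → ∀ᵐ y ∂ν, q η y = m y * q ξ y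

theorem exists_mul_bounded {m : Y → ℂ} (hm : Measurable m) {c : ℝ} (hc : ∀ y, ‖m y‖ ≤ c)
    (ξ : Lp ℂ 2 ν) : ∃ η : Lp ℂ 2 ν, ∀ᵐ y ∂ν, η y = m y * ξ y := by
  have h : MemLp (fun y => m y * ξ y) 2 ν := (Lp.memLp ξ).of_le_mul (c := c)
    (hm.aestronglyMeasurable.mul (Lp.aestronglyMeasurable ξ))
    (Filter.Eventually.of_forall fun y => by
      rw [norm_mul]
      exact mul_le_mul_of_nonneg_right (hc y) (norm_nonneg _))
  exact ⟨h.toLp _, h.coeFn_toLp⟩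

theorem CommutesWithMul.add {q : Lp ℂ 2 ν →L[ℂ] Lp ℂ 2 ν} {m m' : Y → ℂ}
    (h : CommutesWithMul q m) (h' : CommutesWithMul q m')
    (hm : Measurable m) {c : ℝ} (hc : ∀ y, ‖m y‖ ≤ c) :
    CommutesWithMul q (fun y => m y + m' y) := by
  intro ξ η hη
  obtain ⟨ζ, hζ⟩ := exists_mul_bounded hm hc ξ
  have h2 := h' ξ (η - ζ) (by
    filter_upwards [hη, hζ, Lp.coeFn_sub η ζ] with y h1 h2 h3
    rw [h3, Pi.sub_apply, h1, h2]
    ring)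
  rw [map_sub] at h2
  filter_upwards [h ξ ζ hζ, h2, Lp.coeFn_sub (q η) (q ζ)] with y h1 h2 h3
  rw [h3, Pi.sub_apply, h1] at h2
  rw [add_mul, ← h2]
  ring

theorem CommutesWithMul.mul {q : Lp ℂ 2 ν →L[ℂ] Lp ℂ 2 ν} {m m' : Y → ℂ}
    (h : CommutesWithMul q m) (h' : CommutesWithMul q m')
    (hm : Measurable m) {c : ℝ} (hc : ∀ y, ‖m y‖ ≤ c) :
    CommutesWithMul q (fun y => m y * m' y) := by
  intro ξ η hη
  obtain ⟨ζ, hζ⟩ := exists_mul_bounded hm hc ξ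
  have h2 := h' ζ η (by
    filter_upwards [hη, hζ] with y h1 h2
    rw [h1, h2]
    ring)
  filter_upwards [h ξ ζ hζ, h2] with y h1 h2
  rw [h2, h1]
  ring

theorem commutesWithMul_const (q : Lp ℂ 2 ν →L[ℂ] Lp ℂ 2 ν) (c : ℂ) :
    CommutesWithMul q (fun _ => c) := by
  intro ξ η hη
  have : η = c • ξ := by
    refine Lp.ext ?_
    filter_upwards [hη, Lp.coeFn_smul c ξ] with y h1 h2
    rw [h1, h2, Pi.smul_apply, smul_eq_mul]
  rw [this, map_smul]
  filter_upwards [Lp.coeFn_smul c (q ξ)] with y h2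
  rw [h2, Pi.smul_apply, smul_eq_mul]

theorem commutesWithMul_indicator {Z : Type} [TopologicalSpace Z] [PolishSpace Z]
    [MeasurableSpace Z] [BorelSpace Z] {ψ : Y → Z} (hψ : Measurable ψ)
    (q : Lp ℂ 2 ν →L[ℂ] Lp ℂ 2 ν) {I : Type} (c : I → Z →ᵇ ℂ)
    (hc : ∀ i, CommutesWithMul q fun y => c i (ψ y))
    (hc' : ∀ i, CommutesWithMul q fun y => star (c i) (ψ y))
    (hsep : ∀ z z', z ≠ z' → ∃ i, c i z ≠ c i z') {E : Set Z} (hE : MeasurableSet E) :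
    CommutesWithMul q ((ψ ⁻¹' E).indicator 1) := by
  have hsm : ∀ s : Z →ᵇ ℂ, Measurable fun y => s (ψ y) := fun s =>
    s.continuous.measurable.comp hψ
  have hsb : ∀ (s : Z →ᵇ ℂ) y, ‖s (ψ y)‖ ≤ ‖s‖ := fun s y => s.norm_coe_le_norm _
  let 𝒮 : StarSubalgebra ℂ (Z →ᵇ ℂ) :=
    { carrier := {s | CommutesWithMul q (fun y => s (ψ y)) ∧
        CommutesWithMul q (fun y => star s (ψ y))}
      mul_mem' := fun {s t} hs ht => ⟨hs.1.mul ht.1 (hsm _) (hsb _), by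
        have := hs.2.mul ht.2 (hsm _) (hsb _)
        simpa [mul_comm] using this⟩
      add_mem' := fun {s t} hs ht => ⟨hs.1.add ht.1 (hsm _) (hsb _), by
        have := hs.2.add ht.2 (hsm _) (hsb _)
        simpa using this⟩
      algebraMap_mem' := fun r => ⟨commutesWithMul_const q r,
        commutesWithMul_const q (star r)⟩
      star_mem' := fun {s} hs => ⟨hs.2, by simpa using hs.1⟩ }
  have hsep' : (𝒮.map (BoundedContinuousFunction.toContinuousMapStarₐ ℂ)).SeparatesPoints := by
    intro z z' hz
    obtain ⟨i, hi⟩ := hsep z z' hz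
    exact ⟨c i, ⟨_, ⟨c i, ⟨hc i, hc' i⟩, rfl⟩, rfl⟩, hi⟩
  have hind : ∀ ξ : Lp ℂ 2 ν, ∃ η : Lp ℂ 2 ν, ∀ᵐ y ∂ν,
      η y = (ψ ⁻¹' E).indicator 1 y * ξ y :=
    exists_mul_bounded (measurable_one.indicator (hψ hE)) (c := 1) fun y =>
      (norm_indicator_le_norm_self _ _).trans (by simp)
  intro ξ η hη
  obtain ⟨ζ, hζ⟩ := hind (q ξ)
  suffices h : q η = ζ by
    rw [h]
    exact hζ
  refine ext_inner_left ℂ fun v => ?_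
  rw [← ContinuousLinearMap.adjoint_inner_left]
  set w := ContinuousLinearMap.adjoint q v with hw
  have hi1 := L2.integrable_inner (𝕜 := ℂ) w ξ
  have hi2 := L2.integrable_inner (𝕜 := ℂ) v (q ξ)
  have hF := setIntegral_eq_zero_of_starSubalgebra hψ hsep' (hi1.sub hi2) (fun s hs => by
    obtain ⟨ζ', hζ'⟩ := exists_mul_bounded (hsm s) (hsb s) ξ
    have hq := hs.1 ξ ζ' hζ'
    have h1 : inner ℂ w ζ' = inner ℂ v (q ζ') := by
      rw [hw, ContinuousLinearMap.adjoint_inner_left]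
    rw [L2.inner_def, L2.inner_def, ← sub_eq_zero,
      ← integral_sub (L2.integrable_inner w ζ') (L2.integrable_inner v (q ζ'))] at h1
    rw [← h1]
    refine integral_congr_ae ?_
    filter_upwards [hζ', hq] with y h1 h2
    simp only [Pi.sub_apply, h1, h2, RCLike.inner_apply]
    ring) hE
  rw [integral_sub' hi1.integrableOn hi2.integrableOn, sub_eq_zero,
    ← integral_indicator (hψ hE), ← integral_indicator (hψ hE)] at hF
  rw [L2.inner_def, L2.inner_def]
  refine Eq.trans ?_ (hF.trans ?_)
  · refine integral_congr_ae ?_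
    filter_upwards [hη] with y hy
    rw [hy]
    by_cases h : y ∈ ψ ⁻¹' E <;> simp [h]
  · refine integral_congr_ae ?_
    filter_upwards [hζ] with y hy
    rw [hy]
    by_cases h : y ∈ ψ ⁻¹' E <;> simp [h]

end CommutesWithMul

theorem sum_le_sq_of_orthogonal {K ι : Type} [NormedAddCommGroup K] [InnerProductSpace ℂ K]
    [DecidableEq ι] (P : Finset ι) (a b : ι → K) (t : ι → ℝ) (u w : K)
    (ha : ∀ i j, inner ℂ (a i) (a j) = if i = j then (t i : ℂ) else 0)
    (hb : ∀ i j, inner ℂ (b i) (b j) = if i = j then (t i : ℂ) else 0)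
    (h : ∀ i, (t i : ℂ) = inner ℂ w (a i) - inner ℂ (b i) u) :
    ∑ i ∈ P, t i ≤ (‖w‖ + ‖u‖) ^ 2 := by
  have hn : ∀ c : ι → K, (∀ i j, inner ℂ (c i) (c j) = if i = j then (t i : ℂ) else 0) →
      ‖∑ i ∈ P, c i‖ ^ 2 = ∑ i ∈ P, t i := fun c hc => by
    have : ((‖∑ i ∈ P, c i‖ ^ 2 : ℝ) : ℂ) = ((∑ i ∈ P, t i : ℝ) : ℂ) := by
      push_cast
      have h1 := inner_self_eq_norm_sq_to_K (𝕜 := ℂ) (∑ i ∈ P, c i)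
      rw [sum_inner] at h1
      simp only [inner_sum, hc] at h1
      simpa using h1.symm
    exact_mod_cast this
  have hM : (0 : ℝ) ≤ ∑ i ∈ P, t i := by
    rw [← hn a ha]
    positivity
  have hna : ‖∑ i ∈ P, a i‖ = √(∑ i ∈ P, t i) := by
    rw [← hn a ha, Real.sqrt_sq (norm_nonneg _)]
  have hnb : ‖∑ i ∈ P, b i‖ = √(∑ i ∈ P, t i) := by
    rw [← hn b hb, Real.sqrt_sq (norm_nonneg _)]
  have hsum : ((∑ i ∈ P, t i : ℝ) : ℂ) =
      inner ℂ w (∑ i ∈ P, a i) - inner ℂ (∑ i ∈ P, b i) u := by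
    rw [inner_sum, sum_inner, ← Finset.sum_sub_distrib]
    push_cast
    exact Finset.sum_congr rfl fun i _ => h i
  have hle : ∑ i ∈ P, t i ≤ (‖w‖ + ‖u‖) * √(∑ i ∈ P, t i) := by
    calc ∑ i ∈ P, t i = ‖((∑ i ∈ P, t i : ℝ) : ℂ)‖ := by
          rw [Complex.norm_real, Real.norm_of_nonneg hM]
      _ ≤ ‖inner ℂ w (∑ i ∈ P, a i)‖ + ‖inner ℂ (∑ i ∈ P, b i) u‖ := by
          rw [hsum]
          exact norm_sub_le _ _
      _ ≤ ‖w‖ * ‖∑ i ∈ P, a i‖ + ‖∑ i ∈ P, b i‖ * ‖u‖ :=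
          add_le_add (norm_inner_le_norm _ _) (norm_inner_le_norm _ _)
      _ = _ := by
          rw [hna, hnb]
          ring
  nlinarith [Real.sq_sqrt hM, Real.sqrt_nonneg (∑ i ∈ P, t i), norm_nonneg w, norm_nonneg u,
    sq_nonneg (‖w‖ + ‖u‖ - √(∑ i ∈ P, t i))]

theorem inner_map_inv_left {W K : Type} [Group W] [NormedAddCommGroup K] [InnerProductSpace ℂ K]
    (ρ : W →* (K →L[ℂ] K)) (hρ : ∀ s, ‖ρ s‖ ≤ 1) (s : W) (u f : K) :
    inner ℂ (ρ s⁻¹ u) f = inner ℂ u (ρ s f) := by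
  have hle : ∀ s x, ‖ρ s x‖ ≤ ‖x‖ := fun s x => by
    simpa using (ρ s).le_of_opNorm_le (hρ s) x
  have hinv : ∀ s x, ρ s (ρ s⁻¹ x) = x := fun s x => by
    change (ρ s * ρ s⁻¹) x = x
    rw [← map_mul, mul_inv_cancel, map_one]
    rfl
  let U : K →ₗᵢ[ℂ] K := ⟨(ρ s).toLinearMap, fun x => le_antisymm (hle s x) (by
    have h1 := hinv s⁻¹ x
    rw [inv_inv] at h1
    exact (congrArg norm h1).symm.le.trans (hle s⁻¹ (ρ s x)))⟩
  have := U.inner_map_map (ρ s⁻¹ u) f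
  rw [← this]
  exact congrArg (fun z => inner ℂ z (ρ s f)) (hinv s u)

section FiberIndicator

variable {X G : Type} [MeasurableSpace X] (μ : Measure X) [IsFiniteMeasure μ] [Countable G]
  [MeasurableSpace G] [MeasurableSingletonClass G]

theorem prod_count_singleton_ne_top (B : Set X) (h : G) :
    (μ.prod Measure.count) (B ×ˢ {h}) ≠ ⊤ := by
  rw [Measure.prod_prod, Measure.count_singleton, mul_one]
  exact measure_ne_top _ _

/-- The indicator function of `B × {h}` in `L²(X × G)`. -/
noncomputable def fiberIndicator {B : Set X} (hB : MeasurableSet B) (h : G) :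
    Lp ℂ 2 (μ.prod (Measure.count : Measure G)) :=
  indicatorConstLp 2 (hB.prod (measurableSet_singleton h)) (prod_count_singleton_ne_top μ B h) 1

theorem fiberIndicator_ae {B : Set X} (hB : MeasurableSet B) (h : G) :
    ∀ᵐ x ∂μ, ∀ k, fiberIndicator μ hB h (x, k) = (B ×ˢ {h}).indicator (fun _ => 1) (x, k) :=
  ae_prod_count_iff.1 indicatorConstLp_coeFn

theorem inner_fiberIndicator {B : Set X} (hB : MeasurableSet B) (h : G)
    (f : Lp ℂ 2 (μ.prod (Measure.count : Measure G))) :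
    inner ℂ (fiberIndicator μ hB h) f = ∫ p in B ×ˢ {h}, f p ∂(μ.prod Measure.count) :=
  L2.inner_indicatorConstLp_one _ _ _

theorem inner_fiberIndicator_fiberIndicator [DecidableEq G] {B B' : Set X} (hB : MeasurableSet B)
    (hB' : MeasurableSet B') (h h' : G) :
    inner ℂ (fiberIndicator μ hB h) (fiberIndicator μ hB' h') =
      if h = h' then (μ.real (B ∩ B') : ℂ) else 0 := by
  rw [fiberIndicator, fiberIndicator, L2.inner_indicatorConstLp_one_indicatorConstLp_one _ _
    (prod_count_singleton_ne_top μ B h) (prod_count_singleton_ne_top μ B' h')]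
  split_ifs with hh
  · subst hh
    rw [Set.prod_inter_prod, Set.inter_self, measureReal_def, Measure.prod_prod,
      Measure.count_singleton, mul_one]
    rfl
  · rw [Set.prod_inter_prod,
      Set.singleton_inter_eq_empty.2 (fun hm => hh (Set.mem_singleton_iff.1 hm)),
      Set.prod_empty]
    simp

end FiberIndicator

theorem exists_invariant_conull {G X : Type} [Group G] [Countable G] [MulAction G X]
    [MeasurableSpace X] {μ : Measure X}
    (hG : ∀ g : G, MeasurePreserving (fun x : X => g • x) μ μ) {P : X → Prop}
    (hP : ∀ᵐ x ∂μ, P x) :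
    ∃ s : Set X, MeasurableSet s ∧ (∀ᵐ x ∂μ, x ∈ s) ∧ (∀ x, ∀ g : G, g • x ∈ s ↔ x ∈ s) ∧
      ∀ x ∈ s, P x := by
  obtain ⟨T, hT, hTm, hTP⟩ := hP.exists_measurable_mem
  have hTae : ∀ᵐ x ∂μ, x ∈ T := hT
  refine ⟨⋂ g : G, (fun x => g • x) ⁻¹' T, MeasurableSet.iInter fun g => (hG g).measurable hTm,
    ?_, fun x g => ?_, fun x hx => ?_⟩
  · simp only [Set.mem_iInter, ae_all_iff]
    exact fun g => (hG g).quasiMeasurePreserving.ae hTae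
  · simp only [Set.mem_iInter, Set.mem_preimage, ← mul_smul]
    exact ⟨fun h k => by simpa using h (k * g⁻¹), fun h k => h (k * g)⟩
  · have := Set.mem_iInter.1 hx 1
    rw [Set.mem_preimage, one_smul] at this
    exact hTP _ this

theorem inner_fiberIndicator_map {G X : Type} [Countable G] [MeasurableSpace X] {μ : Measure X}
    [IsFiniteMeasure μ] [MeasurableSpace G] [MeasurableSingletonClass G] {E : Set X}
    (hE : MeasurableSet E) {q : Lp ℂ 2 (μ.prod (Measure.count : Measure G)) →L[ℂ]
      Lp ℂ 2 (μ.prod (Measure.count : Measure G))}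
    (hq : CommutesWithMul q ((Prod.fst ⁻¹' E : Set (X × G)).indicator 1)) (h g : G) :
    inner ℂ (fiberIndicator μ hE h) (q (fiberIndicator μ MeasurableSet.univ g)) =
      inner ℂ (fiberIndicator μ MeasurableSet.univ h) (q (fiberIndicator μ hE g)) := by
  classical
  have hqv := hq (fiberIndicator μ MeasurableSet.univ g) (fiberIndicator μ hE g) (by
    refine ae_prod_count_iff.2 ?_
    filter_upwards [fiberIndicator_ae μ MeasurableSet.univ g, fiberIndicator_ae μ hE g]
      with x h1 h2 k
    rw [h1, h2]
    simp only [Set.indicator_apply, Set.mem_prod, Set.mem_singleton_iff, Set.mem_preimage,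
      Set.mem_univ, true_and, Pi.one_apply]
    split_ifs <;> simp_all)
  rw [inner_fiberIndicator, inner_fiberIndicator]
  have hm : MeasurableSet (Prod.fst ⁻¹' E : Set (X × G)) := measurable_fst hE
  have : ∫ p in Set.univ ×ˢ {h}, q (fiberIndicator μ hE g) p ∂(μ.prod Measure.count) =
      ∫ p in Set.univ ×ˢ {h}, (Prod.fst ⁻¹' E : Set (X × G)).indicator
        (fun p => q (fiberIndicator μ MeasurableSet.univ g) p) p ∂(μ.prod Measure.count) := by
    refine integral_congr_ae (ae_restrict_of_ae ?_)
    filter_upwards [hqv] with p hp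
    rw [hp]
    simp only [Set.indicator_apply, Pi.one_apply]
    split_ifs <;> simp
  rw [this, setIntegral_indicator hm]
  congr 2
  ext p
  simp [and_comm]

section Rooted

variable {G X : Type} [Group G] [Countable G] [MulAction G X] [MeasurableSpace X]
  {μ : Measure X} [IsFiniteMeasure μ] [MeasurableSpace G] [DiscreteMeasurableSpace G]

theorem map_fiberIndicator (hG : ∀ g : G, MeasurePreserving (fun x : X => g • x) μ μ)
    {N : Type} [Group N] {φ : G →* MulAut N} {χ : N →* (X → Circle)}
    {T : Lp ℂ 2 (μ.prod (Measure.count : Measure G)) →L[ℂ]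
      Lp ℂ 2 (μ.prod (Measure.count : Measure G))} {g : G}
    (hT : ∀ f, ∀ᵐ x ∂μ, ∀ h, T f (x, h) =
      twistedTranslation χ (SemidirectProduct.inr g : N ⋊[φ] G) f (x, h))
    {B : Set X} (hB : MeasurableSet B) (h : G) :
    T (fiberIndicator μ hB h) =
      fiberIndicator μ ((hG g⁻¹).measurable hB) (g * h) := by
  classical
  refine Lp.ext (ae_prod_count_iff.2 ?_)
  filter_upwards [hT (fiberIndicator μ hB h), fiberIndicator_ae μ ((hG g⁻¹).measurable hB) (g * h),
    (hG g⁻¹).quasiMeasurePreserving.ae (fiberIndicator_ae μ hB h)] with x h1 h2 h3 k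
  rw [h1, h2]
  simp only [twistedTranslation, SemidirectProduct.left_inr, SemidirectProduct.right_inr, map_one,
    Pi.one_apply, Circle.coe_one, one_mul, h3]
  simp only [Set.indicator_apply, Set.mem_prod, Set.mem_singleton_iff, Set.mem_preimage,
    inv_mul_eq_iff_eq_mul]

theorem inner_fiberIndicator_derivation
    (hG : ∀ g : G, MeasurePreserving (fun x : X => g • x) μ μ)
    {N : Type} [Group N] {φ : G →* MulAut N} {χ : N →* (X → Circle)}
    {Q : X → G → G → Prop} (hQu : ∀ x h k k', Q x h k → Q x h k' → k = k')
    (hQ1 : ∀ x k, ¬ Q x 1 k)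
    {D : Lp ℂ 2 (μ.prod (Measure.count : Measure G)) →L[ℂ]
      Lp ℂ 2 (μ.prod (Measure.count : Measure G))} {g : G}
    (hD : ∀ f, ∀ᵐ x ∂μ, ∀ h, D f (x, h) =
      parentOp Q (twistedTranslation χ (SemidirectProduct.inr g : N ⋊[φ] G) f) (x, h) -
        twistedTranslation χ (SemidirectProduct.inr g : N ⋊[φ] G) (parentOp Q f) (x, h))
    {E : Set X} (hE : MeasurableSet E) (hEQ : ∀ x ∈ E, Q (g⁻¹ • x) g⁻¹ 1) :
    inner ℂ (fiberIndicator μ hE 1) (D (fiberIndicator μ MeasurableSet.univ 1)) =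
      -(μ.real E : ℂ) := by
  rw [inner_fiberIndicator]
  have : ∫ p in E ×ˢ {1}, D (fiberIndicator μ MeasurableSet.univ 1) p ∂(μ.prod Measure.count) =
      ∫ p in E ×ˢ {(1 : G)}, (-1 : ℂ) ∂(μ.prod Measure.count) := by
    refine setIntegral_congr_ae (hE.prod (measurableSet_singleton _)) (ae_prod_count_iff.2 ?_)
    filter_upwards [hD (fiberIndicator μ MeasurableSet.univ 1),
      (hG g⁻¹).quasiMeasurePreserving.ae (fiberIndicator_ae μ MeasurableSet.univ (1 : G))]
      with x h1 h2 k hk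
    obtain ⟨hx, rfl⟩ : x ∈ E ∧ k = 1 := hk
    have hex : ∃ k, Q (g⁻¹ • x) g⁻¹ k := ⟨1, hEQ x hx⟩
    have hch : hex.choose = 1 := hQu _ _ _ _ hex.choose_spec (hEQ x hx)
    rw [h1]
    simp [parentOp, twistedTranslation, hQ1, hex, hch, h2]
  rw [this, setIntegral_const, measureReal_def, Measure.prod_prod, Measure.count_singleton,
    mul_one]
  simp [measureReal_def]

end Rooted

theorem derivation_inl_eq_zero {N G X : Type} [Group N] [Group G] [Countable G] [MulAction G X]
    [MeasurableSpace X] {μ : Measure X} [SFinite μ] [MeasurableSpace G] [DiscreteMeasurableSpace G]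
    {φ : G →* MulAut N} {χ : N →* (X → Circle)} {Q : X → G → G → Prop}
    {D : Lp ℂ 2 (μ.prod (Measure.count : Measure G)) →L[ℂ]
      Lp ℂ 2 (μ.prod (Measure.count : Measure G))} {n : N}
    (hD : ∀ f, ∀ᵐ x ∂μ, ∀ h, D f (x, h) =
      parentOp Q (twistedTranslation χ (SemidirectProduct.inl n : N ⋊[φ] G) f) (x, h) -
        twistedTranslation χ (SemidirectProduct.inl n : N ⋊[φ] G) (parentOp Q f) (x, h)) :
    D = 0 := by
  have hT : ∀ u : X × G → ℂ, twistedTranslation χ (SemidirectProduct.inl n : N ⋊[φ] G) u =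
      fun p => χ n p.1 * u p := fun u => by
    funext p
    simp [twistedTranslation]
  refine ContinuousLinearMap.ext fun f => Lp.ext ?_
  refine Filter.EventuallyEq.trans ?_ (Lp.coeFn_zero ℂ 2 _).symm
  refine ae_prod_count_iff.2 ?_
  filter_upwards [hD f] with x hx h
  rw [hx, hT, hT]
  simp only [parentOp, Pi.zero_apply]
  split_ifs <;> simp

theorem commutesWithMul_of_map_inl {N G X : Type} [Group N] [Group G] [Countable G] [MulAction G X]
    [MeasurableSpace X] {μ : Measure X} [SFinite μ] [MeasurableSpace G] [DiscreteMeasurableSpace G]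
    {φ : G →* MulAut N} {χ : N →* (X → Circle)} {n : N}
    {T q : Lp ℂ 2 (μ.prod (Measure.count : Measure G)) →L[ℂ]
      Lp ℂ 2 (μ.prod (Measure.count : Measure G))}
    (hT : ∀ f, ∀ᵐ x ∂μ, ∀ h, T f (x, h) =
      twistedTranslation χ (SemidirectProduct.inl n : N ⋊[φ] G) f (x, h))
    (hTq : T * q = q * T) : CommutesWithMul q fun p => (χ n p.1 : ℂ) := by
  have hT' : ∀ f, ∀ᵐ p ∂(μ.prod (Measure.count : Measure G)), T f p = χ n p.1 * f p := fun f => by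
    refine ae_prod_count_iff.2 ?_
    filter_upwards [hT f] with x hx h
    rw [hx]
    simp [twistedTranslation]
  intro ξ η hη
  have : η = T ξ := Lp.ext (by
    filter_upwards [hη, hT' ξ] with p h1 h2
    rw [h1, h2])
  rw [this]
  have h2 : q (T ξ) = T (q ξ) := (congrArg (fun S => S ξ) hTq).symm
  rw [h2]
  exact hT' _

theorem commutesWithMul_indicator_fst {A G X : Type} [CommGroup A] [MeasurableSpace X]
    [MeasurableSpace G] {ν : Measure (X × G)}
    {q : Lp ℂ 2 ν →L[ℂ] Lp ℂ 2 ν}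
    {φ : A →* (X → Circle)} (hφ : ∀ a, Measurable (φ a)) {S : Set A} (hS : S.Countable)
    (hemb : MeasurableEmbedding fun (x : X) (a : S) => φ a x)
    (hq : ∀ a, CommutesWithMul q fun p => (φ a p.1 : ℂ)) {E : Set X} (hE : MeasurableSet E) :
    CommutesWithMul q ((Prod.fst ⁻¹' E : Set (X × G)).indicator 1) := by
  have : Countable S := hS.to_subtype
  have : PolishSpace Circle := inferInstance
  let c : S → BoundedContinuousFunction (S → Circle) ℂ := fun a =>
    BoundedContinuousFunction.mkOfCompact ⟨fun z => (z a : ℂ), by fun_prop⟩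
  have key := commutesWithMul_indicator (ν := ν) (ψ := fun p a => φ (a : S) p.1)
    (measurable_pi_lambda _ fun a => (hφ a).comp measurable_fst) q c (fun a => hq a)
    (fun a => by
      have := hq (a : A)⁻¹
      simp only [map_inv, Pi.inv_apply, Circle.coe_inv_eq_conj] at this
      exact this)
    (fun z z' h => by
      obtain ⟨a, ha⟩ := Function.ne_iff.1 h
      exact ⟨a, fun h' => ha (Circle.ext h')⟩)
    (hemb.measurableSet_image.2 hE)
  have hpre : (fun (p : X × G) (a : S) => φ a p.1) ⁻¹' ((fun (x : X) (a : S) => φ a x) '' E) =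
      Prod.fst ⁻¹' E := by
    ext p
    exact hemb.injective.mem_set_image
  rwa [hpre] at key

theorem not_isUnitarizableGroup_wreath {G X A : Type} [Group G] [Countable G] [CommGroup A]
    [Infinite A] [MeasurableSpace X] [StandardBorelSpace X] [MulAction G X]
    [MulAction (FreeGroup ℤ) X] (μ : Measure X) [IsProbabilityMeasure μ]
    (hG : ∀ g : G, MeasurePreserving (fun x : X => g • x) μ μ)
    (hΓ : ∀ γ : FreeGroup ℤ, MeasurePreserving (fun x : X => γ • x) μ μ)
    (hfΓ : ∀ᵐ x ∂μ, Function.Injective fun γ : FreeGroup ℤ => γ • x)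
    (hfG : ∀ᵐ x ∂μ, Function.Injective fun g : G => g • x)
    (horb : ∀ᵐ x ∂μ, ∀ γ : FreeGroup ℤ, ∃ g : G, γ • x = g • x) :
    ¬ IsUnitarizableGroup (Wreath A G) := by
  classical
  intro hW
  obtain ⟨good, hgm, hgae, hginv, hgP⟩ := exists_invariant_conull hG (hfΓ.and (hfG.and horb))
  obtain ⟨Q, hQm, hQu, hQb, hQ1, hQof⟩ := exists_parent_relation (fun g => (hG g).measurable)
    (fun γ => (hΓ γ).measurable) good hgm hginv (fun x hx => (hgP x hx).1)
    (fun x hx => (hgP x hx).2.1) (fun x hx => (hgP x hx).2.2)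
  obtain ⟨φ, hφ, S, hS, hemb⟩ := exists_measurable_characters A X
  obtain ⟨χ, hχm, hχ, hχφ⟩ := exists_wreath_characters (fun g => (hG g).measurable) φ hφ
  let _ : MeasurableSpace G := ⊤
  have : DiscreteMeasurableSpace G := ⟨fun _ => trivial⟩
  obtain ⟨ρ, δ, hδ, hρ, hδC, hρT, hδT⟩ := exists_forest_derivation hG χ hχm hχ Q hQm hQu hQb
  obtain ⟨q, hq⟩ := hW.exists_derivation_eq ρ δ hδ hρ hδC
  have hqX : ∀ E : Set X, MeasurableSet E →
      CommutesWithMul q ((Prod.fst ⁻¹' E : Set (X × G)).indicator 1) := fun E hE => by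
    refine commutesWithMul_indicator_fst hφ hS hemb (fun a => ?_) hE
    obtain ⟨n, hn⟩ := hχφ a
    rw [← hn]
    refine commutesWithMul_of_map_inl (hρT (SemidirectProduct.inl n)) (sub_eq_zero.1 ?_)
    rw [← hq, derivation_inl_eq_zero (hδT (SemidirectProduct.inl n))]
  let E : ℤ × G → Set X := fun i =>
    good ∩ {x | (FreeGroup.of i.1 : FreeGroup ℤ)⁻¹ • x = i.2⁻¹ • x}
  have hE : ∀ i, MeasurableSet (E i) := fun i =>
    hgm.inter (measurableSet_eq_fun (hΓ _).measurable (hG _).measurable)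
  have hdisj : ∀ i j : ℤ × G, i.2 = j.2 → i ≠ j → E i ∩ E j = ∅ := by
    rintro ⟨i, g⟩ ⟨j, g'⟩ rfl hne
    refine Set.eq_empty_of_forall_notMem ?_
    rintro x ⟨⟨hx, h1⟩, -, h2⟩
    have h3 : (FreeGroup.of i : FreeGroup ℤ)⁻¹ = (FreeGroup.of j)⁻¹ :=
      (hgP x hx).1 (Eq.trans h1 (Eq.symm h2))
    exact hne (by rw [FreeGroup.of_injective (inv_injective h3)])
  let e := fiberIndicator μ MeasurableSet.univ (1 : G)
  let a : ℤ × G → Lp ℂ 2 (μ.prod (Measure.count : Measure G)) := fun i =>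
    fiberIndicator μ (hE i) i.2
  let b : ℤ × G → Lp ℂ 2 (μ.prod (Measure.count : Measure G)) := fun i =>
    fiberIndicator μ ((hG i.2⁻¹⁻¹).measurable (hE i)) (i.2⁻¹ * 1)
  have ha : ∀ i j, inner ℂ (a i) (a j) = if i = j then (μ.real (E i) : ℂ) else 0 := fun i j => by
    rw [inner_fiberIndicator_fiberIndicator]
    split_ifs with h1 h2 h2
    · rw [h2, Set.inter_self]
    · rw [hdisj i j h1 h2]
      simp
    · exact absurd (congrArg Prod.snd h2) h1
    · rfl
  have hb : ∀ i j, inner ℂ (b i) (b j) = if i = j then (μ.real (E i) : ℂ) else 0 := fun i j => by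
    rw [inner_fiberIndicator_fiberIndicator]
    split_ifs with h1 h2 h2
    · rw [h2, Set.inter_self, measureReal_def,
        (hG _).measure_preimage (hE j).nullMeasurableSet, measureReal_def]
    · have h3 : i.2 = j.2 := by simpa using h1
      rw [← h3, ← Set.preimage_inter, hdisj i j h3 h2]
      simp
    · exact absurd (congrArg (fun k : ℤ × G => k.2⁻¹ * 1) h2) h1
    · rfl
  have hid : ∀ i, (μ.real (E i) : ℂ) =
      inner ℂ (ContinuousLinearMap.adjoint q e) (a i) - inner ℂ (b i) (q e) := fun i => by
    have h1 := inner_fiberIndicator_derivation hG hQu hQ1 (hδT (SemidirectProduct.inr i.2)) (hE i)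
      (fun x hx => by
        have hy : i.2⁻¹ • x = (FreeGroup.of i.1 : FreeGroup ℤ)⁻¹ • x := hx.2.symm
        refine hQof _ ((hginv x _).2 hx.1) i.1 _ ?_
        rw [inv_inv, smul_inv_smul, hy, smul_inv_smul])
    have h2 : b i = ρ (SemidirectProduct.inr i.2)⁻¹ (fiberIndicator μ (hE i) 1) := by
      rw [← map_inv]
      exact (map_fiberIndicator hG (hρT (SemidirectProduct.inr i.2⁻¹)) (hE i) 1).symm
    have h3 : ρ (SemidirectProduct.inr i.2) e = fiberIndicator μ MeasurableSet.univ i.2 := by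
      rw [map_fiberIndicator hG (hρT (SemidirectProduct.inr i.2)), mul_one]
      rfl
    have h4 : δ (SemidirectProduct.inr i.2) e = ρ (SemidirectProduct.inr i.2) (q e) -
        q (ρ (SemidirectProduct.inr i.2) e) := by
      rw [hq]
      rfl
    rw [h2, inner_map_inv_left ρ hρ, ContinuousLinearMap.adjoint_inner_left]
    rw [h4, inner_sub_right, h3, inner_fiberIndicator_map (hE i) (hqX _ (hE i))] at h1
    rw [← neg_sub, h1, neg_neg]
  have hsum := fun P : Finset (ℤ × G) => sum_le_sq_of_orthogonal P a b (fun i => μ.real (E i))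
    (q e) (ContinuousLinearMap.adjoint q e) ha hb hid
  have htop : ∑' i, μ (E i) = ⊤ := by
    have hone : ∀ i : ℤ, 1 ≤ ∑' g : G, μ (E (i, g)) := fun i => by
      rw [← prob_compl_eq_zero_iff hgm |>.1 hgae]
      refine (measure_mono fun x hx => ?_).trans (measure_iUnion_le _)
      obtain ⟨g, hg⟩ := (hgP x hx).2.2 (FreeGroup.of i)⁻¹
      exact Set.mem_iUnion.2 ⟨g⁻¹, hx, by simpa using hg⟩
    refine (ENNReal.tsum_prod (f := fun i g => μ (E (i, g)))).trans (eq_top_iff.2 ?_)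
    calc (⊤ : ENNReal) = ∑' _ : ℤ, 1 := (ENNReal.tsum_const_eq_top_of_ne_zero one_ne_zero).symm
      _ ≤ _ := ENNReal.tsum_le_tsum hone
  have hbdd : ∑' i, μ (E i) ≤
      ENNReal.ofReal ((‖ContinuousLinearMap.adjoint q e‖ + ‖q e‖) ^ 2) := by
    rw [ENNReal.tsum_eq_iSup_sum]
    refine iSup_le fun P => ?_
    refine le_trans (le_of_eq ?_) (ENNReal.ofReal_le_ofReal (hsum P))
    rw [ENNReal.ofReal_sum_of_nonneg fun _ _ => measureReal_nonneg]
    exact Finset.sum_congr rfl fun i _ => (ofReal_measureReal).symm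
  rw [htop, top_le_iff] at hbdd
  exact ENNReal.ofReal_ne_top hbdd

/-- **Monod–Ozawa.**  If the free group `F₂` orbitally embeds in the countable group
`G`, then for every infinite abelian group `A` the wreath product `A ≀ G` is not
unitarizable. -/
theorem statement16 (G : Type) [Group G] [Countable G]
    (horb : Nonempty (OrbitalEmbedding (FreeGroup (Fin 2)) G))
    (A : Type) [CommGroup A] [Infinite A] :
    ¬ IsUnitarizableGroup (Wreath A G) := by
  obtain ⟨O⟩ := horb
  obtain ⟨f, hf⟩ := exists_injective_freeGroup_int_hom
  let _ := O.mX
  have := O.sb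
  have := O.prob
  let _ : MulAction G O.X :=
    { smul := O.aG
      one_smul := O.aG_one
      mul_smul := O.aG_mul }
  let _ : MulAction (FreeGroup ℤ) O.X :=
    { smul := fun γ x => O.aΓ (f γ) x
      one_smul := fun x => by
        change O.aΓ (f 1) x = x
        rw [map_one, O.aΓ_one]
      mul_smul := fun γ γ' x => by
        change O.aΓ (f (γ * γ')) x = O.aΓ (f γ) (O.aΓ (f γ') x)
        rw [map_mul, O.aΓ_mul] }
  exact not_isUnitarizableGroup_wreath O.μ O.mpG (fun γ => O.mpΓ (f γ))
    (O.freeΓ.mono fun x hx => hx.comp hf) O.freeG (O.orbit.mono fun x hx γ => hx (f γ))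
end
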